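/- Let k ∈ {3,4,5} and ε > 0. There is a constant C > 0 such that for every real T ≥ 10 and every real y with 2 ≤ y ≤ T/(2k), one has |∫_T^{2T} R₁^{k−1}(x;y) · R₂*(x;y) dx| ≤ C (T^{1+9k/8+ε} y^{−3/4} + T^{3/4+9k/8+ε} y^{4^{k−2} − 5/4 + k/8}), where R₂*(x;y) = (2π)^{−2} x^{9/8} ∑_{y < n ≤ T} (c_n/n^{7/8}) cos(8π(nx)^{1/4} − π/4). -/

import Mathlib

open Real Finset

/-- `R₁(x; y) = (x^{9/8}/(4π²)) ∑_{n ≤ y} (c_n/n^{7/8}) cos(8π(nx)^{1/4} − π/4)`. -/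
noncomputable def R1 (c : ℕ → ℝ) (x y : ℝ) : ℝ :=
  x ^ ((9 : ℝ) / 8) / (4 * π ^ 2) *
    ∑ n ∈ Finset.Icc 1 ⌊y⌋₊,
      c n / (n : ℝ) ^ ((7 : ℝ) / 8) * Real.cos (8 * π * ((n : ℝ) * x) ^ ((1 : ℝ) / 4) - π / 4)

theorem isIntegral_rat_of_pow_four {x : ℝ} {q : ℚ} (h : x ^ 4 = q) : IsIntegral ℚ x := by
  refine IsIntegral.of_pow (n := 4) (by norm_num) ?_
  rw [h]
  exact isIntegral_algebraMap (R := ℚ) (A := ℝ) (x := q)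

theorem finiteDimensional_adjoin_of_pow_four {ι : Type*} [Finite ι] {γ : ι → ℝ} {q : ι → ℚ}
    (h : ∀ i, γ i ^ 4 = q i) :
    FiniteDimensional ℚ (IntermediateField.adjoin ℚ (Set.range γ)) := by
  refine IntermediateField.finiteDimensional_adjoin ?_
  rintro x ⟨i, rfl⟩
  exact isIntegral_rat_of_pow_four (h i)

theorem finrank_adjoin_le_of_pow_four {ι : Type*} [Fintype ι] {γ : ι → ℝ} {q : ι → ℚ}
    (h : ∀ i, γ i ^ 4 = q i) :
    Module.finrank ℚ (IntermediateField.adjoin ℚ (Set.range γ)) ≤ 4 ^ Fintype.card ι := by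
  classical
  have := finiteDimensional_adjoin_of_pow_four h
  let g : ι → IntermediateField.adjoin ℚ (Set.range γ) :=
    fun i => ⟨γ i, IntermediateField.subset_adjoin ℚ _ ⟨i, rfl⟩⟩
  have hg (i) : g i ^ 4 = algebraMap ℚ _ (q i) := Subtype.ext (h i)
  let R : ι → Finset ℂ := fun i => (Polynomial.X ^ 4 - Polynomial.C (q i : ℂ)).roots.toFinset
  have hR (i) : (R i).card ≤ 4 := by
    refine (Multiset.toFinset_card_le _).trans ((Polynomial.card_roots' _).trans ?_)
    rw [Polynomial.natDegree_X_pow_sub_C]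
  rw [← AlgHom.card ℚ _ ℂ, ← Finset.card_univ]
  calc _ ≤ (Fintype.piFinset R).card := by
        refine Finset.card_le_card_of_injOn (fun σ i => σ (g i)) ?_ ?_
        · intro σ _
          simp only [Finset.mem_coe, Fintype.mem_piFinset, R, Multiset.mem_toFinset]
          intro i
          rw [Polynomial.mem_roots (Polynomial.X_pow_sub_C_ne_zero (by norm_num) _)]
          simp [← map_pow, hg]
        · intro σ _ τ _ hst
          refine IntermediateField.adjoin_algHom_ext ℚ ?_
          rintro x ⟨i, rfl⟩
          exact congrFun hst i
    _ = ∏ i, (R i).card := Fintype.card_piFinset _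
    _ ≤ ∏ _i : ι, 4 := Finset.prod_le_prod' fun i _ => hR i
    _ = _ := by simp

theorem nextCoeff_minpoly_eq_zero_of_pow_four {y : ℝ} {q : ℚ} (h : y ^ 4 = q)
    (hy : ∀ r : ℚ, y ≠ r) : (minpoly ℚ y).nextCoeff = 0 := by
  have hint := isIntegral_rat_of_pow_four h
  have hmonic := minpoly.monic hint
  set p := minpoly ℚ y with hp
  set d := p.natDegree with hd
  have hdvd : p ∣ Polynomial.X ^ 4 - Polynomial.C q := minpoly.dvd ℚ y (by simp [h])
  have hcoeff : |(p.coeff 0 : ℝ)| = |y| ^ d := by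
    have hm : (p.map (algebraMap ℚ ℂ)).Monic := hmonic.map _
    have h1 := (IsAlgClosed.splits (p.map (algebraMap ℚ ℂ))).coeff_zero_eq_prod_roots_of_monic hm
    have hroot : ∀ z ∈ (p.map (algebraMap ℚ ℂ)).roots, ‖z‖ = |y| := by
      intro z hz
      have hz' := (Polynomial.mem_roots hm.ne_zero).1 hz
      have h2 : (Polynomial.X ^ 4 - Polynomial.C q).aeval z = 0 := by
        obtain ⟨s, hs⟩ := hdvd
        rw [hs, map_mul]
        rw [Polynomial.IsRoot.def, Polynomial.eval_map_algebraMap] at hz'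
        rw [hz', zero_mul]
      have h3 : z ^ 4 = ((y ^ 4 : ℝ) : ℂ) := by
        rw [h]
        simpa [sub_eq_zero] using h2
      have h4 : ‖z‖ ^ 4 = |y| ^ 4 := by
        rw [← norm_pow, h3, Complex.norm_real, norm_pow, Real.norm_eq_abs]
      exact (pow_left_inj₀ (norm_nonneg _) (abs_nonneg _) (by norm_num)).1 h4
    have h5 : ‖(p.map (algebraMap ℚ ℂ)).coeff 0‖ = |y| ^ d := by
      have hc : (p.map (algebraMap ℚ ℂ)).roots.card = d := by
        rw [← (IsAlgClosed.splits (p.map (algebraMap ℚ ℂ))).natDegree_eq_card_roots,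
          Polynomial.natDegree_map]
      rw [h1, norm_mul, norm_pow, norm_neg, norm_one, one_pow, one_mul]
      rw [← hc, ← Multiset.prod_replicate, ← Multiset.map_const', ← Multiset.map_congr rfl hroot]
      exact map_multiset_prod (normHom : ℂ →*₀ ℝ) _
    rw [← h5, Polynomial.coeff_map]
    simp [← Real.norm_eq_abs]
  obtain ⟨r, hr⟩ : ∃ r : ℚ, y ^ d = r := by
    rw [← abs_pow, eq_comm, abs_eq_abs] at hcoeff
    rcases hcoeff with hc | hc
    · exact ⟨_, hc⟩
    · exact ⟨-p.coeff 0, by rw [hc]; push_cast; ring⟩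
  have hdpos : 0 < d := minpoly.natDegree_pos hint
  have hd1 : d ≠ 1 := by
    intro hd1
    rw [hd1, pow_one] at hr
    exact hy r hr
  have hpeq : Polynomial.X ^ d - Polynomial.C r = p := by
    refine minpoly.unique ℚ y (Polynomial.monic_X_pow_sub_C _ hdpos.ne') (by simp [hr]) ?_
    intro s hs hs0
    rw [Polynomial.degree_X_pow_sub_C hdpos, hd, ← Polynomial.degree_eq_natDegree hmonic.ne_zero]
    exact minpoly.min ℚ y hs hs0
  rw [Polynomial.nextCoeff_of_natDegree_pos hdpos, ← hd, ← hpeq, Polynomial.coeff_sub,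
    Polynomial.coeff_X_pow, Polynomial.coeff_C]
  rw [if_neg (by omega), if_neg (by omega), sub_zero]

/-- A rational combination of real fourth roots of rationals whose value is rational equals the
sum of its rational terms. -/
theorem sum_filter_rational_of_pow_four {ι : Type*} [Fintype ι] {γ : ι → ℝ} {q : ι → ℚ}
    (h : ∀ i, γ i ^ 4 = q i) (s : ι → ℚ) (t : ℚ) (hsum : ∑ i, (s i : ℝ) * γ i = t)
    [DecidablePred fun i => ∃ r : ℚ, γ i = r] :
    ∑ i with ∃ r : ℚ, γ i = r, (s i : ℝ) * γ i = t := by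
  have := finiteDimensional_adjoin_of_pow_four h
  set K := IntermediateField.adjoin ℚ (Set.range γ)
  let g : ι → K := fun i => ⟨γ i, IntermediateField.subset_adjoin ℚ _ ⟨i, rfl⟩⟩
  have hD : (Module.finrank ℚ K : ℝ) ≠ 0 := by
    exact_mod_cast (Module.finrank_pos (R := ℚ) (M := K)).ne'
  have hsum' : ∑ i, s i • g i = algebraMap ℚ K t := by
    apply Subtype.ext
    push_cast
    simpa [Algebra.smul_def] using hsum
  have htr := congrArg (Algebra.trace ℚ K) hsum'
  rw [map_sum, Algebra.trace_algebraMap] at htr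
  have hterm (i) : ((Algebra.trace ℚ K (s i • g i) : ℚ) : ℝ) =
      if ∃ r : ℚ, γ i = r then Module.finrank ℚ K * ((s i : ℝ) * γ i) else 0 := by
    rw [map_smul]
    split_ifs with hi
    · obtain ⟨r, hr⟩ := hi
      have : g i = algebraMap ℚ K r := Subtype.ext hr
      rw [this, Algebra.trace_algebraMap, hr]
      push_cast [smul_eq_mul, nsmul_eq_mul]
      ring
    · have hmp : minpoly ℚ (g i) = minpoly ℚ (γ i) :=
        (minpoly.algebraMap_eq (algebraMap K ℝ).injective (g i)).symm
      rw [trace_eq_finrank_mul_minpoly_nextCoeff, hmp,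
        nextCoeff_minpoly_eq_zero_of_pow_four (h i) (by simpa using hi)]
      simp
  have htr' := congrArg (fun x : ℚ => (x : ℝ)) htr
  simp only [Rat.cast_sum, hterm] at htr'
  rw [← Finset.sum_filter, ← Finset.mul_sum, nsmul_eq_mul] at htr'
  push_cast at htr'
  exact mul_left_cancel₀ hD htr'

theorem one_le_abs_mul_pow_of_ne_zero {ι : Type*} [Fintype ι] {u : ι → ℝ} {n : ι → ℕ}
    (hu0 : ∀ i, 0 ≤ u i) (hu : ∀ i, u i ^ 4 = n i) {v : ℝ} {m : ℕ} (hv0 : 0 < v)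
    (hv : v ^ 4 = m) (s : ι → ℤ) (hs : ∀ i, |s i| ≤ 1) (hne : v + ∑ i, (s i : ℝ) * u i ≠ 0) :
    1 ≤ |v + ∑ i, (s i : ℝ) * u i| * (v + ∑ i, u i) ^ (4 ^ Fintype.card ι - 1) := by
  classical
  set δ := v + ∑ i, (s i : ℝ) * u i with hδ
  set S := v + ∑ i, u i with hS
  have hm0 : (0 : ℝ) < m := hv ▸ pow_pos hv0 4
  have hv1 : 1 ≤ v := by
    have : (1 : ℝ) ≤ m := by exact_mod_cast Nat.one_le_iff_ne_zero.2 (by exact_mod_cast hm0.ne')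
    rw [← hv] at this
    exact (one_le_pow_iff_of_nonneg hv0.le (by norm_num)).1 this
  have hS1 : 1 ≤ S := by
    have := Finset.sum_nonneg fun i (_ : i ∈ Finset.univ) => hu0 i
    linarith
  let γ : ι → ℝ := fun i => u i / v
  let q : ι → ℚ := fun i => n i / m
  have hγ (i) : γ i ^ 4 = q i := by simp [γ, q, div_pow, hu, hv]
  have := finiteDimensional_adjoin_of_pow_four hγ
  have hrank := finrank_adjoin_le_of_pow_four hγ
  set K := IntermediateField.adjoin ℚ (Set.range γ)
  let g : ι → K := fun i => ⟨γ i, IntermediateField.subset_adjoin ℚ _ ⟨i, rfl⟩⟩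
  have hg (i) : g i ^ 4 = algebraMap ℚ _ (q i) := Subtype.ext (hγ i)
  let x : K := m * (1 + ∑ i, (s i : K) * g i) ^ 4
  have hx : algebraMap K ℝ x = δ ^ 4 := by
    have h1 : algebraMap K ℝ x = m * (1 + ∑ i, (s i : ℝ) * γ i) ^ 4 := by
      simp only [x, map_mul, map_natCast, map_pow, map_add, map_one, map_sum, map_intCast]
      rfl
    rw [h1, ← hv, ← mul_pow, mul_add, mul_one, Finset.mul_sum, hδ]
    congr 2
    refine Finset.sum_congr rfl fun i _ => ?_
    simp only [γ]
    field_simp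
  have hxint : IsIntegral ℤ x := by
    rw [← isIntegral_algebraMap_iff (algebraMap K ℝ).injective, hx]
    have hnat (w : ℝ) (a : ℕ) (hw : w ^ 4 = a) : IsIntegral ℤ w :=
      IsIntegral.of_pow (n := 4) (by norm_num)
        (by rw [hw]; exact_mod_cast isIntegral_algebraMap (R := ℤ) (A := ℝ) (x := a))
    refine ((hnat v m hv).add (IsIntegral.sum _ fun i _ => ?_)).pow 4
    exact (isIntegral_algebraMap (R := ℤ) (A := ℝ) (x := s i)).mul (hnat _ _ (hu i))
  have hx0 : x ≠ 0 := by
    intro h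
    rw [h, map_zero] at hx
    exact hne (pow_eq_zero_iff (by norm_num) |>.1 hx.symm)
  obtain ⟨N, hN⟩ := IsIntegrallyClosed.isIntegral_iff.1 (Algebra.isIntegral_norm ℚ hxint)
  have hN0 : N ≠ 0 := by
    rintro rfl
    rw [map_zero, eq_comm, Algebra.norm_eq_zero_iff] at hN
    exact hx0 hN
  have hprod : (1 : ℝ) ≤ ∏ σ : K →ₐ[ℚ] ℂ, ‖σ x‖ := by
    rw [← norm_prod, ← Algebra.norm_eq_prod_embeddings ℚ ℂ x, ← hN]
    have : (1 : ℝ) ≤ |(N : ℝ)| := by exact_mod_cast Int.one_le_abs hN0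
    simpa using this
  have hbound (σ : K →ₐ[ℚ] ℂ) : ‖σ x‖ ≤ S ^ 4 := by
    have hgi (i) : ‖σ (g i)‖ = γ i := by
      have h4 : ‖σ (g i)‖ ^ 4 = γ i ^ 4 := by
        rw [← norm_pow, ← map_pow, hg, hγ]
        have : (0 : ℚ) ≤ q i := by positivity
        simp [abs_of_nonneg (show (0 : ℝ) ≤ q i by exact_mod_cast this)]
      exact (pow_left_inj₀ (norm_nonneg _) (div_nonneg (hu0 i) hv0.le) (by norm_num)).1 h4
    have hle : ‖1 + ∑ i, (s i : ℂ) * σ (g i)‖ ≤ 1 + ∑ i, γ i := by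
      refine (norm_add_le _ _).trans ?_
      rw [norm_one]
      gcongr
      refine norm_sum_le_of_le _ fun i _ => ?_
      rw [norm_mul, hgi, Complex.norm_intCast]
      have h1 : |(s i : ℝ)| ≤ 1 := by exact_mod_cast hs i
      have h2 : 0 ≤ γ i := div_nonneg (hu0 i) hv0.le
      nlinarith
    have h1 : σ x = m * (1 + ∑ i, (s i : ℂ) * σ (g i)) ^ 4 := by simp [x]
    have h2 : S = v * (1 + ∑ i, γ i) := by
      rw [mul_add, mul_one, Finset.mul_sum, hS]
      congr 1
      refine Finset.sum_congr rfl fun i _ => ?_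
      simp only [γ]
      field_simp
    rw [h1, h2, mul_pow, hv, norm_mul, norm_pow, Complex.norm_natCast]
    gcongr
  let σ₀ : K →ₐ[ℚ] ℂ := ((Complex.ofRealAm).restrictScalars ℚ).comp K.val
  have hσ₀ : ‖σ₀ x‖ = |δ| ^ 4 := by
    have h1 : σ₀ x = ((algebraMap K ℝ x : ℝ) : ℂ) := rfl
    rw [h1, hx, Complex.norm_real, norm_pow, Real.norm_eq_abs]
  have hcard : (Finset.univ.erase σ₀).card ≤ 4 ^ Fintype.card ι - 1 := by
    rw [Finset.card_erase_of_mem (Finset.mem_univ _), Finset.card_univ, AlgHom.card]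
    omega
  have hfin : 1 ≤ (|δ| * S ^ (4 ^ Fintype.card ι - 1)) ^ 4 := by
    calc (1 : ℝ) ≤ ∏ σ : K →ₐ[ℚ] ℂ, ‖σ x‖ := hprod
      _ = ‖σ₀ x‖ * ∏ σ ∈ Finset.univ.erase σ₀, ‖σ x‖ :=
        (Finset.mul_prod_erase _ _ (Finset.mem_univ _)).symm
      _ ≤ |δ| ^ 4 * ∏ σ ∈ Finset.univ.erase σ₀, S ^ 4 := by
        rw [hσ₀]
        gcongr with σ
        exact hbound σ
      _ = |δ| ^ 4 * (S ^ 4) ^ (Finset.univ.erase σ₀).card := by rw [Finset.prod_const]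
      _ ≤ |δ| ^ 4 * (S ^ 4) ^ (4 ^ Fintype.card ι - 1) := by
        gcongr
        exact one_le_pow₀ hS1
      _ = _ := by rw [mul_pow, ← pow_mul, ← pow_mul, mul_comm 4]
  exact (one_le_pow_iff_of_nonneg (by positivity) (by norm_num)).1 hfin

theorem exists_eq_pow_four_mul {m : ℕ} (hm : 0 < m) :
    ∃ d q : ℕ, m = d ^ 4 * q ∧ ∀ v, v ^ 4 ∣ q → v = 1 := by
  induction m using Nat.strong_induction_on with
  | _ m ih =>
    by_cases h : ∀ v, v ^ 4 ∣ m → v = 1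
    · exact ⟨1, m, by simp, h⟩
    · push Not at h
      obtain ⟨v, ⟨m', rfl⟩, hv⟩ := h
      have hm' : 0 < m' := Nat.pos_of_mul_pos_left hm
      have hv0 : v ≠ 0 := by
        rintro rfl
        simp at hm
      have hlt : m' < v ^ 4 * m' :=
        lt_mul_of_one_lt_left hm' (Nat.one_lt_pow (by norm_num) (by omega))
      obtain ⟨d, q, hd, hq⟩ := ih m' hlt hm'
      exact ⟨v * d, q, by rw [hd]; ring, hq⟩

theorem exists_nat_eq_of_mul_pow_four {q n : ℕ} (hq : ∀ v, v ^ 4 ∣ q → v = 1) {ρ : ℚ}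
    (hρ : 0 ≤ ρ) (h : q * ρ ^ 4 = n) : ∃ a : ℕ, ρ = a := by
  have hden : (ρ.den : ℚ) ≠ 0 := by exact_mod_cast ρ.den_nz
  have hnum : (ρ.num.natAbs : ℚ) = ρ.num := by
    rw [Nat.cast_natAbs, abs_of_nonneg (Rat.num_nonneg.2 hρ)]
  have h1 : q * ρ.num.natAbs ^ 4 = n * ρ.den ^ 4 := by
    have : (q : ℚ) * (ρ.num.natAbs : ℚ) ^ 4 = n * (ρ.den : ℚ) ^ 4 := by
      rw [hnum, ← h]
      nth_rewrite 2 [← Rat.num_div_den ρ]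
      field_simp
    exact_mod_cast this
  have h2 : ρ.den ^ 4 ∣ q :=
    (ρ.reduced.symm.pow 4 4).dvd_of_dvd_mul_right (Dvd.intro_left _ h1.symm)
  refine ⟨ρ.num.natAbs, ?_⟩
  rw [hnum]
  nth_rewrite 1 [← Rat.num_div_den ρ]
  rw [hq _ h2]
  simp

/-- In a vanishing signed sum of real fourth roots of positive integers, where one radicand `m` is
the largest, at least two of the others lie in the class of `m` modulo fourth powers. -/
theorem exists_pair_of_sum_eq_zero {ι : Type*} [Fintype ι] {u : ι → ℝ} {n : ι → ℕ}
    (hu0 : ∀ i, 0 ≤ u i) (hu : ∀ i, u i ^ 4 = n i) {v : ℝ} {m : ℕ} (hv0 : 0 < v)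
    (hv : v ^ 4 = m) (s : ι → ℤ) (hs : ∀ i, |s i| ≤ 1) (hnm : ∀ i, n i < m)
    (h0 : v + ∑ i, (s i : ℝ) * u i = 0) :
    ∃ i j, i ≠ j ∧ m ≤ Fintype.card ι ^ 4 * n i ∧
      ∃ q a b d : ℕ, n i = a ^ 4 * q ∧ n j = b ^ 4 * q ∧ m = d ^ 4 * q := by
  classical
  have hm0 : (0 : ℝ) < m := hv ▸ pow_pos hv0 4
  let γ : ι → ℝ := fun i => u i / v
  have hγ0 (i) : 0 ≤ γ i := div_nonneg (hu0 i) hv0.le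
  have hγ4 (i) : γ i ^ 4 = n i / m := by simp [γ, div_pow, hu, hv]
  have hγ1 (i) : γ i < 1 := by
    rw [← pow_lt_one_iff_of_nonneg (hγ0 i) (by norm_num : 4 ≠ 0), hγ4, div_lt_one hm0]
    exact_mod_cast hnm i
  have hsum : ∑ i, ((s i : ℚ) : ℝ) * γ i = ((-1 : ℚ) : ℝ) := by
    have : ∑ i, (s i : ℝ) * u i = -v := by linarith
    simp only [γ, ← mul_div_assoc, ← Finset.sum_div, Rat.cast_intCast, this]
    push_cast
    field_simp
  have hJ := sum_filter_rational_of_pow_four (q := fun i => (n i / m : ℚ))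
    (fun i => by rw [hγ4]; push_cast; rfl) (fun i => (s i : ℚ)) (-1) hsum
  set J := Finset.univ.filter fun i => ∃ r : ℚ, γ i = r with hJdef
  push_cast at hJ
  have hsγ (i) : -((s i : ℝ) * γ i) ≤ γ i := by
    have h1 : -(1 : ℝ) ≤ s i := by exact_mod_cast (abs_le.1 (hs i)).1
    nlinarith [hγ0 i]
  have hJ1 : 1 ≤ ∑ i ∈ J, γ i := by
    calc (1 : ℝ) = ∑ i ∈ J, -((s i : ℝ) * γ i) := by rw [Finset.sum_neg_distrib, hJ, neg_neg]
      _ ≤ _ := Finset.sum_le_sum fun i _ => hsγ i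
  have hJne : J.Nonempty := by
    by_contra h
    rw [Finset.not_nonempty_iff_eq_empty.1 h, Finset.sum_empty] at hJ1
    linarith
  have hr : (0 : ℝ) < Fintype.card ι := by
    exact_mod_cast Fintype.card_pos_iff.2 ⟨hJne.choose⟩
  obtain ⟨i, hiJ, hi⟩ : ∃ i ∈ J, 1 / (Fintype.card ι : ℝ) ≤ γ i := by
    by_contra! h
    have h1 : ∑ i ∈ J, γ i < ∑ i ∈ J, 1 / (Fintype.card ι : ℝ) := Finset.sum_lt_sum_of_nonempty hJne h
    have h2 : (J.card : ℝ) ≤ Fintype.card ι := by exact_mod_cast Finset.card_le_univ J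
    rw [Finset.sum_const, nsmul_eq_mul, mul_one_div] at h1
    have h3 := (div_le_one hr).2 h2
    linarith
  obtain ⟨j, hjJ, hij⟩ : ∃ j ∈ J, j ≠ i := by
    by_contra! h
    have hJi : J = {i} := Finset.eq_singleton_iff_unique_mem.2 ⟨hiJ, h⟩
    rw [hJi, Finset.sum_singleton] at hJ1
    linarith [hγ1 i]
  refine ⟨i, j, hij.symm, ?_, ?_⟩
  · have h1 : (1 / (Fintype.card ι : ℝ)) ^ 4 ≤ n i / m := by
      rw [← hγ4]
      gcongr
    rw [div_pow, one_pow, div_le_div_iff₀ (by positivity) hm0, one_mul, mul_comm] at h1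
    exact_mod_cast h1
  · obtain ⟨d, q, hmd, hq⟩ := exists_eq_pow_four_mul (m := m) (by exact_mod_cast hm0)
    have key (l : ι) (hl : l ∈ J) : ∃ a : ℕ, n l = a ^ 4 * q := by
      obtain ⟨r, hlr⟩ := (Finset.mem_filter.1 hl).2
      have hr0 : 0 ≤ r := by exact_mod_cast hlr ▸ hγ0 l
      have h4 : (q : ℚ) * (d * r) ^ 4 = n l := by
        have h1 : (r : ℝ) ^ 4 = n l / m := by rw [← hlr, hγ4]
        have h2 : (q : ℝ) * (d * r) ^ 4 = n l := by
          have hmd' : (m : ℝ) = d ^ 4 * q := by exact_mod_cast hmd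
          rw [mul_pow, h1, ← mul_assoc, mul_comm (q : ℝ), ← hmd', mul_div_cancel₀ _ hm0.ne']
        exact_mod_cast h2
      obtain ⟨a, ha⟩ := exists_nat_eq_of_mul_pow_four hq (by positivity) h4
      refine ⟨a, ?_⟩
      rw [ha, mul_comm] at h4
      exact_mod_cast h4.symm
    obtain ⟨a, ha⟩ := key i hiJ
    obtain ⟨b, hb⟩ := key j hjJ
    exact ⟨q, a, b, d, ha, hb, hmd⟩

theorem rpow_quarter_pow_four {x : ℝ} (hx : 0 ≤ x) : (x ^ (1 / 4 : ℝ)) ^ 4 = x := by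
  rw [← Real.rpow_natCast, ← Real.rpow_mul hx]
  norm_num

theorem sum_rpow_neg_seven_eighths_le_nat (N : ℕ) :
    ∑ n ∈ Finset.Icc 1 N, (n : ℝ) ^ (-(7 / 8) : ℝ) ≤ 8 * (N : ℝ) ^ (1 / 8 : ℝ) := by
  induction N with
  | zero => simp
  | succ N ih =>
    rw [Finset.sum_Icc_succ_top (by omega)]
    have hpow (x : ℝ) (hx : 0 ≤ x) : (x ^ (1 / 8 : ℝ)) ^ 8 = x := by
      rw [← Real.rpow_natCast, ← Real.rpow_mul hx]
      norm_num
    have hb0 : (0 : ℝ) ≤ N := by positivity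
    have ha0 : (0 : ℝ) < ((N + 1 : ℕ) : ℝ) := by positivity
    have hw : ((N + 1 : ℕ) : ℝ) ^ (-(7 / 8) : ℝ) =
        ((((N + 1 : ℕ) : ℝ) ^ (1 / 8 : ℝ)) ^ 7)⁻¹ := by
      rw [Real.rpow_neg ha0.le, ← Real.rpow_natCast, ← Real.rpow_mul ha0.le]
      norm_num
    rw [hw]
    set a := ((N + 1 : ℕ) : ℝ) ^ (1 / 8 : ℝ) with ha
    set b := (N : ℝ) ^ (1 / 8 : ℝ) with hb
    have ha8 : a ^ 8 = N + 1 := by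
      rw [ha, hpow _ ha0.le]
      push_cast
      rfl
    have hb8 : b ^ 8 = N := hpow _ hb0
    have hapos : 0 < a := Real.rpow_pos_of_pos ha0 _
    have hbpos : 0 ≤ b := Real.rpow_nonneg hb0 _
    have hba : b ≤ a := by
      refine Real.rpow_le_rpow hb0 ?_ (by norm_num)
      push_cast
      linarith
    have h1 : a ^ 8 - b ^ 8 ≤ (a - b) * (8 * a ^ 7) := by
      have e : a ^ 8 - b ^ 8 = (a - b) * (a ^ 7 + a ^ 6 * b + a ^ 5 * b ^ 2 + a ^ 4 * b ^ 3 +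
        a ^ 3 * b ^ 4 + a ^ 2 * b ^ 5 + a * b ^ 6 + b ^ 7) := by ring
      rw [e]
      refine mul_le_mul_of_nonneg_left ?_ (sub_nonneg.2 hba)
      have hij (i j : ℕ) : a ^ i * b ^ j ≤ a ^ (i + j) := by
        rw [pow_add]
        gcongr
      have := hij 6 1
      have := hij 5 2
      have := hij 4 3
      have := hij 3 4
      have := hij 2 5
      have := hij 1 6
      have := hij 0 7
      norm_num at *
      linarith
    have h2 : (a ^ 7)⁻¹ ≤ 8 * (a - b) := by
      rw [inv_le_iff_one_le_mul₀ (by positivity)]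
      nlinarith
    linarith

theorem sum_rpow_neg_seven_eighths_le {y : ℝ} (hy : 0 ≤ y) :
    ∑ n ∈ Finset.Icc 1 ⌊y⌋₊, (n : ℝ) ^ (-(7 / 8) : ℝ) ≤ 8 * y ^ (1 / 8 : ℝ) := by
  refine (sum_rpow_neg_seven_eighths_le_nat _).trans ?_
  gcongr
  exact Nat.floor_le hy

/-- At most one integer in an initial segment has its fourth root very close to a given real. -/
theorem card_le_one_of_fourth_roots_close {s : Finset ℕ} {R t : ℝ} (hR : 0 < R)
    (hs : ∀ m ∈ s, (m : ℝ) ^ (1 / 4 : ℝ) ≤ R ∧ |(m : ℝ) ^ (1 / 4 : ℝ) + t| < (8 * R ^ 3)⁻¹) :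
    s.card ≤ 1 := by
  have key : ∀ m ∈ s, ∀ l ∈ s, m < l → False := by
    intro m hm l hl hml
    obtain ⟨-, hm2⟩ := hs m hm
    obtain ⟨hl1, hl2⟩ := hs l hl
    have hm4 := rpow_quarter_pow_four (Nat.cast_nonneg (α := ℝ) m)
    have hl4 := rpow_quarter_pow_four (Nat.cast_nonneg (α := ℝ) l)
    have hm0 : 0 ≤ (m : ℝ) ^ (1 / 4 : ℝ) := by positivity
    have hmono : (m : ℝ) ^ (1 / 4 : ℝ) ≤ (l : ℝ) ^ (1 / 4 : ℝ) := by
      gcongr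
    have hml' : (m : ℝ) + 1 ≤ l := by exact_mod_cast hml
    set a := (m : ℝ) ^ (1 / 4 : ℝ)
    set b := (l : ℝ) ^ (1 / 4 : ℝ)
    have h1 : 1 ≤ (b - a) * (4 * R ^ 3) := by
      calc (1 : ℝ) ≤ b ^ 4 - a ^ 4 := by rw [hm4, hl4]; linarith
        _ = (b - a) * ((b + a) * (b ^ 2 + a ^ 2)) := by ring
        _ ≤ (b - a) * ((R + R) * (R ^ 2 + R ^ 2)) := by
          have := sub_nonneg.2 hmono
          have : a ≤ R := hmono.trans hl1
          have : 0 ≤ b := hm0.trans hmono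
          gcongr
        _ = _ := by ring
    have h2 : b - a < 2 * (8 * R ^ 3)⁻¹ := by
      have := abs_lt.1 hm2
      have := abs_lt.1 hl2
      linarith
    have h3 : 2 * (8 * R ^ 3)⁻¹ * (4 * R ^ 3) = 1 := by
      field_simp
      norm_num
    have : (b - a) * (4 * R ^ 3) < 1 := h3 ▸ mul_lt_mul_of_pos_right h2 (by positivity)
    linarith
  rw [Finset.card_le_one]
  intro m hm l hl
  rcases lt_trichotomy m l with h | h | h
  · exact (key m hm l hl h).elim
  · exact h
  · exact (key l hl m hm h).elim

theorem sum_weighted_inv_abs_le {P : ℕ} (hP : 7 ≤ P) (r : ℕ) : ∃ C : ℝ, 0 < C ∧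
    ∀ (y t : ℝ) (N : ℕ), 1 ≤ y → |t| ≤ r * y ^ (1 / 4 : ℝ) →
      (∀ m : ℕ, y < m → (m : ℝ) ^ (1 / 4 : ℝ) + t ≠ 0 →
        1 ≤ |(m : ℝ) ^ (1 / 4 : ℝ) + t| * ((m : ℝ) ^ (1 / 4 : ℝ) + r * y ^ (1 / 4 : ℝ)) ^ P) →
      ∑ m ∈ Finset.Ioc ⌊y⌋₊ N, (m : ℝ) ^ (-(7 / 8) : ℝ) * |(m : ℝ) ^ (1 / 4 : ℝ) + t|⁻¹ ≤
        C * (y ^ (-(7 / 8) : ℝ) * (y ^ (1 / 4 : ℝ)) ^ P) := by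
  have hsummable : Summable fun m : ℕ => (m : ℝ) ^ (-(9 / 8) : ℝ) :=
    Real.summable_nat_rpow.2 (by norm_num)
  set Z := ∑' m : ℕ, (m : ℝ) ^ (-(9 / 8) : ℝ)
  have hZ : 0 ≤ Z := tsum_nonneg fun m => by positivity
  set b : ℝ := 2 * r + 2 with hb
  refine ⟨8 * b ^ 7 + (b + r) ^ P + 2 * Z, by positivity, ?_⟩
  intro y t N hy ht hlow
  have hy0 : 0 < y := by linarith
  set β := y ^ (1 / 4 : ℝ) with hβ
  have hβ1 : 1 ≤ β := Real.one_le_rpow hy (by norm_num)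
  have hβ4 : β ^ 4 = y := rpow_quarter_pow_four hy0.le
  set W := y ^ (-(7 / 8) : ℝ) with hW
  have hW0 : 0 < W := Real.rpow_pos_of_pos hy0 _
  have hWβ : 1 ≤ W * β ^ 7 := by
    rw [hW, hβ, ← Real.rpow_natCast, ← Real.rpow_mul hy0.le, ← Real.rpow_add hy0]
    exact Real.one_le_rpow hy (by norm_num)
  set R := b * β with hR
  have hR0 : 0 < R := by positivity
  have hpt : ∀ m ∈ Finset.Ioc ⌊y⌋₊ N,
      (m : ℝ) ^ (-(7 / 8) : ℝ) * |(m : ℝ) ^ (1 / 4 : ℝ) + t|⁻¹ ≤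
        (if (m : ℝ) ^ (1 / 4 : ℝ) ≤ R then W * (8 * R ^ 3) else 0) +
        (if (m : ℝ) ^ (1 / 4 : ℝ) ≤ R ∧ |(m : ℝ) ^ (1 / 4 : ℝ) + t| < (8 * R ^ 3)⁻¹ then
          W * ((b + r) * β) ^ P else 0) + 2 * (m : ℝ) ^ (-(9 / 8) : ℝ) := by
    intro m hm
    have hym : y < m := (Nat.floor_lt hy0.le).1 (Finset.mem_Ioc.1 hm).1
    have hm0 : (0 : ℝ) < m := hy0.trans hym
    have hwW : (m : ℝ) ^ (-(7 / 8) : ℝ) ≤ W :=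
      Real.rpow_le_rpow_of_nonpos hy0 hym.le (by norm_num)
    have hw0 : 0 < (m : ℝ) ^ (-(7 / 8) : ℝ) := Real.rpow_pos_of_pos hm0 _
    have h98 : 0 ≤ 2 * (m : ℝ) ^ (-(9 / 8) : ℝ) := by positivity
    by_cases hnear : (m : ℝ) ^ (1 / 4 : ℝ) ≤ R
    · by_cases hclose : |(m : ℝ) ^ (1 / 4 : ℝ) + t| < (8 * R ^ 3)⁻¹
      · rw [if_pos hnear, if_pos ⟨hnear, hclose⟩]
        have h1 : |(m : ℝ) ^ (1 / 4 : ℝ) + t|⁻¹ ≤ ((b + r) * β) ^ P := by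
          by_cases h0 : (m : ℝ) ^ (1 / 4 : ℝ) + t = 0
          · rw [h0, abs_zero, inv_zero]
            positivity
          · rw [inv_le_iff_one_le_mul₀' (abs_pos.2 h0)]
            refine (hlow m hym h0).trans ?_
            gcongr
            rw [add_mul]
            gcongr
        have h2 := mul_le_mul hwW h1 (by positivity) hW0.le
        have h3 : 0 ≤ W * (8 * R ^ 3) := by positivity
        linarith
      · rw [if_pos hnear, if_neg (fun h => hclose h.2)]
        have h1 : |(m : ℝ) ^ (1 / 4 : ℝ) + t|⁻¹ ≤ 8 * R ^ 3 :=
          inv_le_of_inv_le₀ (by positivity) (not_lt.1 hclose)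
        have h2 := mul_le_mul hwW h1 (by positivity) hW0.le
        linarith
    · rw [if_neg hnear, if_neg (fun h => hnear h.1), zero_add, zero_add]
      have h1 : (m : ℝ) ^ (1 / 4 : ℝ) / 2 ≤ |(m : ℝ) ^ (1 / 4 : ℝ) + t| := by
        refine le_trans ?_ (le_abs_self _)
        have := (abs_le.1 ht).1
        have h3 := not_le.1 hnear
        rw [hR, hb] at h3
        nlinarith
      have hq0 : 0 < (m : ℝ) ^ (1 / 4 : ℝ) := Real.rpow_pos_of_pos hm0 _
      calc (m : ℝ) ^ (-(7 / 8) : ℝ) * |(m : ℝ) ^ (1 / 4 : ℝ) + t|⁻¹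
          ≤ (m : ℝ) ^ (-(7 / 8) : ℝ) * ((m : ℝ) ^ (1 / 4 : ℝ) / 2)⁻¹ := by gcongr
        _ = 2 * (m : ℝ) ^ (-(9 / 8) : ℝ) := by
          rw [show (-(9 / 8) : ℝ) = -(7 / 8) - 1 / 4 by norm_num, Real.rpow_sub hm0]
          field_simp
  have hcard : ((Finset.Ioc ⌊y⌋₊ N).filter
      fun m : ℕ => (m : ℝ) ^ (1 / 4 : ℝ) ≤ R).card ≤ R ^ 4 := by
    have hsub : ((Finset.Ioc ⌊y⌋₊ N).filter fun m : ℕ => (m : ℝ) ^ (1 / 4 : ℝ) ≤ R) ⊆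
        Finset.Icc 1 ⌊R ^ 4⌋₊ := by
      intro m hm
      rw [Finset.mem_filter, Finset.mem_Ioc] at hm
      refine Finset.mem_Icc.2 ⟨by omega, Nat.le_floor ?_⟩
      rw [← rpow_quarter_pow_four (Nat.cast_nonneg (α := ℝ) m)]
      gcongr
      exact hm.2
    refine le_trans (Nat.cast_le.2 (Finset.card_le_card hsub)) ?_
    rw [Nat.card_Icc, Nat.add_sub_cancel]
    exact Nat.floor_le (by positivity)
  have hcard1 : (((Finset.Ioc ⌊y⌋₊ N).filter fun m : ℕ => (m : ℝ) ^ (1 / 4 : ℝ) ≤ R ∧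
      |(m : ℝ) ^ (1 / 4 : ℝ) + t| < (8 * R ^ 3)⁻¹).card : ℝ) ≤ 1 := by
    exact_mod_cast card_le_one_of_fourth_roots_close hR0 fun m hm => (Finset.mem_filter.1 hm).2
  have hβP : β ^ 7 ≤ β ^ P := pow_le_pow_right₀ hβ1 hP
  calc _ ≤ _ := Finset.sum_le_sum hpt
    _ ≤ R ^ 4 * (W * (8 * R ^ 3)) + 1 * (W * ((b + r) * β) ^ P) + 2 * Z := by
      rw [Finset.sum_add_distrib, Finset.sum_add_distrib, ← Finset.sum_filter,
        ← Finset.sum_filter, Finset.sum_const, Finset.sum_const, nsmul_eq_mul, nsmul_eq_mul,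
        ← Finset.mul_sum]
      gcongr
      exact hsummable.sum_le_tsum _ fun m _ => by positivity
    _ = 8 * b ^ 7 * (W * β ^ 7) + (b + r) ^ P * (W * β ^ P) + 2 * Z * 1 := by
      rw [hR, mul_pow (b + r) β P]
      ring
    _ ≤ 8 * b ^ 7 * (W * β ^ P) + (b + r) ^ P * (W * β ^ P) + 2 * Z * (W * β ^ P) := by
      have := hWβ.trans (mul_le_mul_of_nonneg_left hβP hW0.le)
      gcongr
    _ = _ := by ring

theorem sum_piFinset_prod_le {ι : Type*} [Fintype ι] [DecidableEq ι] {y : ℝ} (hy : 0 ≤ y) :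
    ∑ n ∈ Fintype.piFinset fun _ : ι => Finset.Icc 1 ⌊y⌋₊, ∏ i, (n i : ℝ) ^ (-(7 / 8) : ℝ) ≤
      (8 * y ^ (1 / 8 : ℝ)) ^ Fintype.card ι := by
  rw [← Finset.prod_univ_sum (fun _ : ι => Finset.Icc 1 ⌊y⌋₊)
    (fun _ (a : ℕ) => (a : ℝ) ^ (-(7 / 8) : ℝ)), Finset.prod_const, Finset.card_univ]
  gcongr
  exact sum_rpow_neg_seven_eighths_le hy

theorem abs_sum_fourth_roots_le {ι : Type*} [Fintype ι] {s : ι → ℤ} (hs : ∀ i, |s i| ≤ 1)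
    {n : ι → ℕ} {y : ℝ} (hn : ∀ i, (n i : ℝ) ≤ y) :
    |∑ i, (s i : ℝ) * (n i : ℝ) ^ (1 / 4 : ℝ)| ≤ Fintype.card ι * y ^ (1 / 4 : ℝ) := by
  calc _ ≤ ∑ i, |(s i : ℝ) * (n i : ℝ) ^ (1 / 4 : ℝ)| := Finset.abs_sum_le_sum_abs _ _
    _ ≤ ∑ _i : ι, 1 * y ^ (1 / 4 : ℝ) := by
      refine Finset.sum_le_sum fun i _ => ?_
      rw [abs_mul, abs_of_nonneg (by positivity : (0 : ℝ) ≤ (n i : ℝ) ^ (1 / 4 : ℝ))]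
      gcongr
      · exact_mod_cast hs i
      · exact hn i
    _ = _ := by simp

/-- Weighted off-diagonal sum. -/
theorem offdiagonal_sum_le {ι : Type*} [Fintype ι] [DecidableEq ι] (hι : 2 ≤ Fintype.card ι)
    {s : ι → ℤ} (hs : ∀ i, |s i| ≤ 1) :
    ∃ C : ℝ, 0 < C ∧ ∀ (y : ℝ) (N : ℕ), 1 ≤ y →
      ∑ n ∈ Fintype.piFinset fun _ : ι => Finset.Icc 1 ⌊y⌋₊, ∑ m ∈ Finset.Ioc ⌊y⌋₊ N,
        (∏ i, (n i : ℝ) ^ (-(7 / 8) : ℝ)) * (m : ℝ) ^ (-(7 / 8) : ℝ) *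
          |(m : ℝ) ^ (1 / 4 : ℝ) + ∑ i, (s i : ℝ) * (n i : ℝ) ^ (1 / 4 : ℝ)|⁻¹ ≤
      C * ((y ^ (1 / 8 : ℝ)) ^ Fintype.card ι *
        (y ^ (-(7 / 8) : ℝ) * (y ^ (1 / 4 : ℝ)) ^ (4 ^ Fintype.card ι - 1))) := by
  have hP : 7 ≤ 4 ^ Fintype.card ι - 1 := by
    have : 4 ^ 2 ≤ 4 ^ Fintype.card ι := Nat.pow_le_pow_right (by norm_num) hι
    omega
  obtain ⟨C, hC, h⟩ := sum_weighted_inv_abs_le hP (Fintype.card ι)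
  refine ⟨8 ^ Fintype.card ι * C, by positivity, fun y N hy => ?_⟩
  have hy0 : 0 < y := by linarith
  have hinner : ∀ n ∈ Fintype.piFinset fun _ : ι => Finset.Icc 1 ⌊y⌋₊,
      ∑ m ∈ Finset.Ioc ⌊y⌋₊ N, (m : ℝ) ^ (-(7 / 8) : ℝ) *
        |(m : ℝ) ^ (1 / 4 : ℝ) + ∑ i, (s i : ℝ) * (n i : ℝ) ^ (1 / 4 : ℝ)|⁻¹ ≤
      C * (y ^ (-(7 / 8) : ℝ) * (y ^ (1 / 4 : ℝ)) ^ (4 ^ Fintype.card ι - 1)) := by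
    intro n hn
    have hny (i) : (n i : ℝ) ≤ y :=
      (Nat.le_floor_iff hy0.le).1 (Finset.mem_Icc.1 (Fintype.mem_piFinset.1 hn i)).2
    refine h y _ N hy (abs_sum_fourth_roots_le hs hny) fun m hm hne => ?_
    have hm0 : (0 : ℝ) < m := hy0.trans hm
    refine (one_le_abs_mul_pow_of_ne_zero (fun i => by positivity)
      (fun i => rpow_quarter_pow_four (Nat.cast_nonneg (n i))) (Real.rpow_pos_of_pos hm0 _)
      (rpow_quarter_pow_four hm0.le) s hs hne).trans ?_
    have hle : ∑ i, (n i : ℝ) ^ (1 / 4 : ℝ) ≤ Fintype.card ι * y ^ (1 / 4 : ℝ) := by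
      have := abs_sum_fourth_roots_le (s := fun _ => 1) (by simp) hny
      simp only [Int.cast_one, one_mul] at this
      exact (le_abs_self _).trans this
    gcongr
  calc _ = ∑ n ∈ Fintype.piFinset fun _ : ι => Finset.Icc 1 ⌊y⌋₊,
        (∏ i, (n i : ℝ) ^ (-(7 / 8) : ℝ)) * ∑ m ∈ Finset.Ioc ⌊y⌋₊ N, (m : ℝ) ^ (-(7 / 8) : ℝ) *
        |(m : ℝ) ^ (1 / 4 : ℝ) + ∑ i, (s i : ℝ) * (n i : ℝ) ^ (1 / 4 : ℝ)|⁻¹ := by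
        simp only [Finset.mul_sum, mul_assoc]
    _ ≤ ∑ n ∈ Fintype.piFinset fun _ : ι => Finset.Icc 1 ⌊y⌋₊,
        (∏ i, (n i : ℝ) ^ (-(7 / 8) : ℝ)) *
        (C * (y ^ (-(7 / 8) : ℝ) * (y ^ (1 / 4 : ℝ)) ^ (4 ^ Fintype.card ι - 1))) := by
        gcongr with n hn
        exact hinner n hn
    _ ≤ (8 * y ^ (1 / 8 : ℝ)) ^ Fintype.card ι *
        (C * (y ^ (-(7 / 8) : ℝ) * (y ^ (1 / 4 : ℝ)) ^ (4 ^ Fintype.card ι - 1))) := by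
        rw [← Finset.sum_mul]
        gcongr
        exact sum_piFinset_prod_le hy0.le
    _ = _ := by
        rw [mul_pow]
        ring

/-- Parameters `(q, b, a, d)` describing triples `(a ^ 4 * q, b ^ 4 * q, d ^ 4 * q)`. -/
noncomputable def classParams (r : ℕ) (y : ℝ) : Finset (Σ _ : ℕ, ℕ × ℕ × ℕ) :=
  (Finset.Icc 1 ⌊y⌋₊).sigma fun q => Finset.Icc 1 ⌊y⌋₊ ×ˢ
    Finset.Icc 1 ⌊(y / q) ^ (1 / 4 : ℝ)⌋₊ ×ˢ Finset.Icc 1 ⌊r * (y / q) ^ (1 / 4 : ℝ)⌋₊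

theorem sum_classParams_le (r : ℕ) : ∃ C : ℝ, 0 < C ∧ ∀ y : ℝ, 0 < y →
    ∑ p ∈ classParams r y, ((p.2.1 ^ 4 * p.1 : ℕ) : ℝ) ^ (-(7 / 8) : ℝ) ≤
      C * y ^ (1 / 2 : ℝ) := by
  have hs1 : Summable fun q : ℕ => (q : ℝ) ^ (-(11 / 8) : ℝ) :=
    Real.summable_nat_rpow.2 (by norm_num)
  have hs2 : Summable fun q : ℕ => (q : ℝ) ^ (-(7 / 2) : ℝ) :=
    Real.summable_nat_rpow.2 (by norm_num)
  set Z₁ := ∑' q : ℕ, (q : ℝ) ^ (-(11 / 8) : ℝ)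
  set Z₂ := ∑' q : ℕ, (q : ℝ) ^ (-(7 / 2) : ℝ)
  have hZ₁ : 0 ≤ Z₁ := tsum_nonneg fun m => by positivity
  have hZ₂ : 0 ≤ Z₂ := tsum_nonneg fun m => by positivity
  refine ⟨r * Z₁ * Z₂ + 1, by positivity, fun y hy => ?_⟩
  have hinner : ∀ q ∈ Finset.Icc 1 ⌊y⌋₊,
      ∑ p ∈ Finset.Icc 1 ⌊y⌋₊ ×ˢ Finset.Icc 1 ⌊(y / q) ^ (1 / 4 : ℝ)⌋₊ ×ˢ
        Finset.Icc 1 ⌊r * (y / q) ^ (1 / 4 : ℝ)⌋₊, ((p.1 ^ 4 * q : ℕ) : ℝ) ^ (-(7 / 8) : ℝ) ≤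
      r * y ^ (1 / 2 : ℝ) * Z₂ * (q : ℝ) ^ (-(11 / 8) : ℝ) := by
    intro q hq
    have hq0 : (0 : ℝ) < q := by exact_mod_cast (Finset.mem_Icc.1 hq).1
    set A := (y / q) ^ (1 / 4 : ℝ) with hA
    have hA0 : 0 ≤ A := by positivity
    have hAA : A * A * (q : ℝ) ^ (-(7 / 8) : ℝ) = y ^ (1 / 2 : ℝ) * (q : ℝ) ^ (-(11 / 8) : ℝ) := by
      rw [hA, ← Real.rpow_add (by positivity), Real.div_rpow hy.le hq0.le, div_eq_mul_inv,
        ← Real.rpow_neg hq0.le, mul_assoc, ← Real.rpow_add hq0]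
      norm_num
    rw [Finset.sum_product]
    simp only [Finset.sum_const, nsmul_eq_mul, Finset.card_product, Nat.card_Icc,
      Nat.add_sub_cancel]
    have hb (b : ℕ) : ((b ^ 4 * q : ℕ) : ℝ) ^ (-(7 / 8) : ℝ) =
        (b : ℝ) ^ (-(7 / 2) : ℝ) * (q : ℝ) ^ (-(7 / 8) : ℝ) := by
      push_cast
      rw [Real.mul_rpow (by positivity) hq0.le, ← Real.rpow_natCast, ← Real.rpow_mul (by positivity)]
      norm_num
    simp only [hb]
    rw [← Finset.mul_sum, ← Finset.sum_mul]
    push_cast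
    calc (⌊A⌋₊ : ℝ) * ⌊r * A⌋₊ * ((∑ b ∈ Finset.Icc 1 ⌊y⌋₊, (b : ℝ) ^ (-(7 / 2) : ℝ)) *
          (q : ℝ) ^ (-(7 / 8) : ℝ))
        ≤ A * (r * A) * (Z₂ * (q : ℝ) ^ (-(7 / 8) : ℝ)) := by
          gcongr
          · exact Nat.floor_le hA0
          · exact Nat.floor_le (by positivity)
          · exact hs2.sum_le_tsum _ fun m _ => by positivity
      _ = r * Z₂ * (A * A * (q : ℝ) ^ (-(7 / 8) : ℝ)) := by ring
      _ = _ := by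
        rw [hAA]
        ring
  rw [classParams, Finset.sum_sigma]
  refine (Finset.sum_le_sum hinner).trans ?_
  rw [← Finset.mul_sum]
  have h1 : ∑ q ∈ Finset.Icc 1 ⌊y⌋₊, (q : ℝ) ^ (-(11 / 8) : ℝ) ≤ Z₁ :=
    hs1.sum_le_tsum _ fun m _ => by positivity
  have h2 : 0 ≤ y ^ (1 / 2 : ℝ) := by positivity
  calc _ ≤ r * y ^ (1 / 2 : ℝ) * Z₂ * Z₁ := by gcongr
    _ ≤ _ := by nlinarith

theorem sum_piFinset_prod_two_fixed_le {ι : Type*} [Fintype ι] [DecidableEq ι] {i j : ι}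
    (hij : i ≠ j) (a b : ℕ) {y : ℝ} (hy : 0 ≤ y) :
    ∑ n ∈ Fintype.piFinset fun _ : ι => Finset.Icc 1 ⌊y⌋₊,
      ∏ l, (if l = i then (if n l = a then 1 else 0) else if l = j then (if n l = b then 1 else 0)
        else (n l : ℝ) ^ (-(7 / 8) : ℝ)) ≤ (8 * y ^ (1 / 8 : ℝ)) ^ (Fintype.card ι - 2) := by
  rw [← Finset.prod_univ_sum (fun _ : ι => Finset.Icc 1 ⌊y⌋₊)
    (fun l (x : ℕ) => if l = i then (if x = a then 1 else 0) else if l = j then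
      (if x = b then 1 else 0) else (x : ℝ) ^ (-(7 / 8) : ℝ))]
  calc _ ≤ ∏ l : ι, if l = i ∨ l = j then 1 else 8 * y ^ (1 / 8 : ℝ) := by
        refine Finset.prod_le_prod (fun l _ => Finset.sum_nonneg fun x _ => ?_) fun l _ => ?_
        · split_ifs <;> positivity
        · by_cases hi : l = i
          · simp only [hi, if_true, true_or, Finset.sum_ite_eq']
            split_ifs <;> norm_num
          · by_cases hj : l = j
            · simp only [hj, hij.symm, if_true, if_false, or_true, Finset.sum_ite_eq']
              split_ifs <;> norm_num
            · simp only [hi, hj, if_false, or_self]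
              exact sum_rpow_neg_seven_eighths_le hy
    _ = _ := by
        rw [Finset.prod_ite, Finset.prod_const_one, one_mul, Finset.prod_const]
        congr 1
        rw [Finset.filter_not, Finset.card_sdiff_of_subset (Finset.filter_subset _ _),
          Finset.card_univ]
        congr 1
        have : (Finset.univ.filter fun l => l = i ∨ l = j) = {i, j} := by
          ext l
          simp
        rw [this, Finset.card_pair hij]

/-- Weighted diagonal sum. -/
theorem diagonal_sum_le {ι : Type*} [Fintype ι] [DecidableEq ι] {s : ι → ℤ}
    (hs : ∀ i, |s i| ≤ 1) :
    ∃ C : ℝ, 0 < C ∧ ∀ (y : ℝ) (N : ℕ), 1 ≤ y →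
      ∑ n ∈ Fintype.piFinset fun _ : ι => Finset.Icc 1 ⌊y⌋₊, ∑ m ∈ Finset.Ioc ⌊y⌋₊ N,
        (if (m : ℝ) ^ (1 / 4 : ℝ) + ∑ i, (s i : ℝ) * (n i : ℝ) ^ (1 / 4 : ℝ) = 0 then
          (∏ i, (n i : ℝ) ^ (-(7 / 8) : ℝ)) * (m : ℝ) ^ (-(7 / 8) : ℝ) else 0) ≤
      C * (y ^ (-(5 / 4) : ℝ) * (y ^ (1 / 8 : ℝ)) ^ (Fintype.card ι - 2)) := by
  obtain ⟨C, hC, hsumC⟩ := sum_classParams_le (Fintype.card ι)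
  set r := Fintype.card ι with hr
  let w : ℕ → ℝ := fun x => (x : ℝ) ^ (-(7 / 8) : ℝ)
  have hw0 (x : ℕ) : 0 ≤ w x := by positivity
  let G (i j : ι) (p : Σ _ : ℕ, ℕ × ℕ × ℕ) (n : ι → ℕ) (l : ι) : ℝ :=
    if l = i then (if n l = p.2.2.1 ^ 4 * p.1 then 1 else 0) else
      if l = j then (if n l = p.2.1 ^ 4 * p.1 then 1 else 0) else w (n l)
  have hG0 (i j p n l) : 0 ≤ G i j p n l := by
    simp only [G]
    split_ifs <;> positivity
  refine ⟨r ^ 2 * r ^ 4 * C * 8 ^ (r - 2) + 1, by positivity, fun y N hy => ?_⟩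
  have hy0 : 0 < y := by linarith
  set W := y ^ (-(7 / 8) : ℝ) with hW
  have hW0 : 0 < W := Real.rpow_pos_of_pos hy0 _
  let F (ij : ι × ι) (p : Σ _ : ℕ, ℕ × ℕ × ℕ) (n : ι → ℕ) (m : ℕ) : ℝ :=
    (r ^ 4 * W * W * w (p.2.1 ^ 4 * p.1)) * (∏ l, G ij.1 ij.2 p n l) *
      (if m = p.2.2.2 ^ 4 * p.1 then 1 else 0)
  have hF0 (ij p n m) : 0 ≤ F ij p n m := by
    have := Finset.prod_nonneg fun l (_ : l ∈ Finset.univ) => hG0 ij.1 ij.2 p n l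
    simp only [F, w]
    split_ifs <;> positivity
  have hpt : ∀ n ∈ Fintype.piFinset fun _ : ι => Finset.Icc 1 ⌊y⌋₊, ∀ m ∈ Finset.Ioc ⌊y⌋₊ N,
      (if (m : ℝ) ^ (1 / 4 : ℝ) + ∑ i, (s i : ℝ) * (n i : ℝ) ^ (1 / 4 : ℝ) = 0 then
        (∏ i, w (n i)) * w m else 0) ≤
      ∑ ij ∈ Finset.univ.offDiag, ∑ p ∈ classParams r y, F ij p n m := by
    intro n hn m hm
    have hmem (i) := Finset.mem_Icc.1 (Fintype.mem_piFinset.1 hn i)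
    have hny (i) : (n i : ℝ) ≤ y := (Nat.le_floor_iff hy0.le).1 (hmem i).2
    have hym : y < m := (Nat.floor_lt hy0.le).1 (Finset.mem_Ioc.1 hm).1
    have hm0 : (0 : ℝ) < m := hy0.trans hym
    split_ifs with h0
    swap
    · exact Finset.sum_nonneg fun ij _ => Finset.sum_nonneg fun p _ => hF0 _ _ _ _
    obtain ⟨i, j, hij, hmi, q, a, b, d, ha, hb, hd⟩ := exists_pair_of_sum_eq_zero
      (fun i => by positivity) (fun i => rpow_quarter_pow_four (Nat.cast_nonneg (n i)))
      (Real.rpow_pos_of_pos hm0 _) (rpow_quarter_pow_four hm0.le) s hs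
      (fun i => by exact_mod_cast (hny i).trans_lt hym) h0
    have hi1 := (hmem i).1
    have hj1 := (hmem j).1
    have hq1 : 1 ≤ q := Nat.one_le_iff_ne_zero.2 (by rintro rfl; simp at ha; omega)
    have ha1 : 1 ≤ a := Nat.one_le_iff_ne_zero.2 (by rintro rfl; simp at ha; omega)
    have hb1 : 1 ≤ b := Nat.one_le_iff_ne_zero.2 (by rintro rfl; simp at hb; omega)
    have hd1 : 1 ≤ d := Nat.one_le_iff_ne_zero.2 (by rintro rfl; simp [hd] at hm0)
    have hq0 : (0 : ℝ) < q := by exact_mod_cast hq1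
    have haq : (a : ℝ) ≤ (y / q) ^ (1 / 4 : ℝ) := by
      have h1 : (a : ℝ) ^ 4 ≤ ((y / q) ^ (1 / 4 : ℝ)) ^ 4 := by
        rw [rpow_quarter_pow_four (by positivity), le_div_iff₀ hq0]
        have := hny i
        rw [ha] at this
        exact_mod_cast this
      exact le_of_pow_le_pow_left₀ (by norm_num) (by positivity) h1
    have hmr : m ≤ r ^ 4 * n i := hmi
    have hdq : (d : ℝ) ≤ r * (y / q) ^ (1 / 4 : ℝ) := by
      have h1 : (d : ℝ) ^ 4 ≤ (r * (y / q) ^ (1 / 4 : ℝ)) ^ 4 := by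
        rw [mul_pow, rpow_quarter_pow_four (by positivity), mul_div_assoc', le_div_iff₀ hq0]
        have h2 : (m : ℝ) ≤ r ^ 4 * n i := by exact_mod_cast hmr
        have h3 : (m : ℝ) = d ^ 4 * q := by exact_mod_cast hd
        rw [← h3]
        exact h2.trans (by gcongr; exact hny i)
      exact le_of_pow_le_pow_left₀ (by norm_num) (by positivity) h1
    have hqj : q ≤ n j := hb ▸ Nat.le_mul_of_pos_left _ (by positivity)
    have hbj : b ≤ n j := hb ▸ (Nat.le_self_pow (by norm_num) b).trans
      (Nat.le_mul_of_pos_right _ hq1)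
    have hp : (⟨q, b, a, d⟩ : Σ _ : ℕ, ℕ × ℕ × ℕ) ∈ classParams r y := by
      simp only [classParams, Finset.mem_sigma, Finset.mem_product, Finset.mem_Icc]
      exact ⟨⟨hq1, hqj.trans (hmem j).2⟩, ⟨hb1, hbj.trans (hmem j).2⟩,
        ⟨ha1, Nat.le_floor haq⟩, hd1, Nat.le_floor hdq⟩
    have hwm : w m ≤ W := Real.rpow_le_rpow_of_nonpos hy0 hym.le (by norm_num)
    have hr1 : 1 ≤ r := Fintype.card_pos_iff.2 ⟨i⟩
    have hr0 : (0 : ℝ) < r := by exact_mod_cast hr1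
    have hwi : w (n i) ≤ r ^ 4 * W := by
      have h1 : y / r ^ 4 ≤ n i := by
        rw [div_le_iff₀' (by positivity)]
        exact hym.le.trans (by exact_mod_cast hmr)
      calc w (n i) ≤ (y / r ^ 4) ^ (-(7 / 8) : ℝ) :=
            Real.rpow_le_rpow_of_nonpos (by positivity) h1 (by norm_num)
        _ = ((r : ℝ) ^ 4) ^ (7 / 8 : ℝ) * W := by
            rw [Real.div_rpow hy0.le (by positivity), Real.rpow_neg (by positivity : (0 : ℝ) ≤ r ^ 4),
              div_inv_eq_mul, mul_comm]
        _ ≤ ((r : ℝ) ^ 4) ^ (1 : ℝ) * W := by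
            gcongr
            · exact one_le_pow₀ (by exact_mod_cast hr1)
            · norm_num
        _ = _ := by rw [Real.rpow_one]
    have hprod : ∏ l, w (n l) = w (n i) * w (n j) * ∏ l, G i j ⟨q, b, a, d⟩ n l := by
      have h1 (l) : w (n l) = (if l = i then w (n i) else 1) * (if l = j then w (n j) else 1) *
          G i j ⟨q, b, a, d⟩ n l := by
        by_cases hli : l = i
        · subst hli
          simp [G, hij, ha]
        · by_cases hlj : l = j
          · subst hlj
            simp [G, hli, hb]
          · simp [G, hli, hlj]
      rw [Finset.prod_congr rfl fun l _ => h1 l, Finset.prod_mul_distrib, Finset.prod_mul_distrib,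
        Finset.prod_ite_eq' , Finset.prod_ite_eq']
      simp
    calc (∏ l, w (n l)) * w m
        = w (n i) * w (n j) * (∏ l, G i j ⟨q, b, a, d⟩ n l) * w m := by rw [hprod]
      _ ≤ (r ^ 4 * W) * w (n j) * (∏ l, G i j ⟨q, b, a, d⟩ n l) * W := by
          have := Finset.prod_nonneg fun l (_ : l ∈ Finset.univ) => hG0 i j ⟨q, b, a, d⟩ n l
          have := hw0 (n j)
          have := hw0 (n i)
          have := hw0 m
          gcongr
      _ = F (i, j) ⟨q, b, a, d⟩ n m := by
          simp only [F, if_pos hd, ← hb]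
          ring
      _ ≤ ∑ p ∈ classParams r y, F (i, j) p n m :=
          Finset.single_le_sum (f := fun p => F (i, j) p n m) (fun p _ => hF0 _ _ _ _) hp
      _ ≤ _ := Finset.single_le_sum (f := fun ij => ∑ p ∈ classParams r y, F ij p n m)
          (fun ij _ => Finset.sum_nonneg fun p _ => hF0 _ _ _ _)
          (Finset.mem_offDiag.2 ⟨Finset.mem_univ i, Finset.mem_univ j, hij⟩)
  have hFsum (ij : ι × ι) (hij : ij ∈ Finset.univ.offDiag) (p : Σ _ : ℕ, ℕ × ℕ × ℕ) :
      ∑ n ∈ Fintype.piFinset fun _ : ι => Finset.Icc 1 ⌊y⌋₊, ∑ m ∈ Finset.Ioc ⌊y⌋₊ N, F ij p n m ≤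
      (r ^ 4 * W * W * (8 * y ^ (1 / 8 : ℝ)) ^ (r - 2)) * w (p.2.1 ^ 4 * p.1) := by
    have h1 (n : ι → ℕ) : ∑ m ∈ Finset.Ioc ⌊y⌋₊ N, F ij p n m ≤
        (r ^ 4 * W * W * w (p.2.1 ^ 4 * p.1)) * (∏ l, G ij.1 ij.2 p n l) := by
      have := Finset.prod_nonneg fun l (_ : l ∈ Finset.univ) => hG0 ij.1 ij.2 p n l
      have := hw0 (p.2.1 ^ 4 * p.1)
      simp only [F]
      rw [← Finset.mul_sum, Finset.sum_ite_eq']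
      refine mul_le_of_le_one_right (by positivity) ?_
      split_ifs <;> norm_num
    refine (Finset.sum_le_sum fun n _ => h1 n).trans ?_
    rw [← Finset.mul_sum]
    have h2 := sum_piFinset_prod_two_fixed_le (Finset.mem_offDiag.1 hij).2.2
      (p.2.2.1 ^ 4 * p.1) (p.2.1 ^ 4 * p.1) hy0.le
    have := hw0 (p.2.1 ^ 4 * p.1)
    calc _ ≤ (r ^ 4 * W * W * w (p.2.1 ^ 4 * p.1)) * (8 * y ^ (1 / 8 : ℝ)) ^ (r - 2) :=
          mul_le_mul_of_nonneg_left h2 (by positivity)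
      _ = _ := by ring
  calc _ ≤ ∑ n ∈ Fintype.piFinset fun _ : ι => Finset.Icc 1 ⌊y⌋₊, ∑ m ∈ Finset.Ioc ⌊y⌋₊ N,
        ∑ ij ∈ Finset.univ.offDiag, ∑ p ∈ classParams r y, F ij p n m :=
        Finset.sum_le_sum fun n hn => Finset.sum_le_sum fun m hm => hpt n hn m hm
    _ = ∑ ij ∈ Finset.univ.offDiag, ∑ p ∈ classParams r y,
        ∑ n ∈ Fintype.piFinset fun _ : ι => Finset.Icc 1 ⌊y⌋₊, ∑ m ∈ Finset.Ioc ⌊y⌋₊ N,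
          F ij p n m := by
        simp_rw [Finset.sum_comm (s := Finset.Ioc ⌊y⌋₊ N)]
        rw [Finset.sum_comm]
        refine Finset.sum_congr rfl fun ij _ => ?_
        rw [Finset.sum_comm]
    _ ≤ ∑ ij ∈ (Finset.univ : Finset ι).offDiag,
        (r ^ 4 * W * W * (8 * y ^ (1 / 8 : ℝ)) ^ (r - 2)) * (C * y ^ (1 / 2 : ℝ)) := by
        refine Finset.sum_le_sum fun ij hij => ?_
        refine (Finset.sum_le_sum fun p _ => hFsum ij hij p).trans ?_
        rw [← Finset.mul_sum]
        exact mul_le_mul_of_nonneg_left (hsumC y hy0) (by positivity)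
    _ ≤ r ^ 2 * ((r ^ 4 * W * W * (8 * y ^ (1 / 8 : ℝ)) ^ (r - 2)) * (C * y ^ (1 / 2 : ℝ))) := by
        rw [Finset.sum_const, nsmul_eq_mul]
        gcongr
        have : (Finset.univ : Finset ι).offDiag.card ≤ r ^ 2 := by
          rw [Finset.offDiag_card, Finset.card_univ, sq]
          exact Nat.sub_le _ _
        exact_mod_cast this
    _ = r ^ 2 * r ^ 4 * C * 8 ^ (r - 2) *
        ((W * W * y ^ (1 / 2 : ℝ)) * (y ^ (1 / 8 : ℝ)) ^ (r - 2)) := by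
        rw [mul_pow]
        ring
    _ = r ^ 2 * r ^ 4 * C * 8 ^ (r - 2) *
        (y ^ (-(5 / 4) : ℝ) * (y ^ (1 / 8 : ℝ)) ^ (r - 2)) := by
        rw [hW, ← Real.rpow_add hy0, ← Real.rpow_add hy0]
        norm_num
    _ ≤ _ := by
        gcongr
        linarith

theorem intervalIntegrable_rpow_mul_cos {T : ℝ} (hT : 0 < T) (α l φ : ℝ) :
    IntervalIntegrable (fun x : ℝ => x ^ α * Real.cos (l * x ^ (1 / 4 : ℝ) + φ))
      MeasureTheory.volume T (2 * T) := by
  refine ContinuousOn.intervalIntegrable fun x hx => ?_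
  rw [Set.uIcc_of_le (by linarith)] at hx
  have hx0 : x ≠ 0 := (hT.trans_le hx.1).ne'
  refine ContinuousAt.continuousWithinAt ?_
  exact (Real.continuousAt_rpow_const _ _ (Or.inl hx0)).mul (Real.continuous_cos.continuousAt.comp
    ((continuousAt_const.mul (Real.continuousAt_rpow_const _ _ (Or.inl hx0))).add
      continuousAt_const))

theorem abs_integral_rpow_mul_cos_le_trivial {T α : ℝ} (hT : 0 < T) (hα : 0 ≤ α) (l φ : ℝ) :
    |∫ x in T..(2 * T), x ^ α * Real.cos (l * x ^ (1 / 4 : ℝ) + φ)| ≤ 2 ^ α * T ^ (α + 1) := by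
  have h := intervalIntegral.norm_integral_le_of_norm_le_const (a := T) (b := 2 * T)
    (f := fun x : ℝ => x ^ α * Real.cos (l * x ^ (1 / 4 : ℝ) + φ)) (C := (2 * T) ^ α) (by
      intro x hx
      rw [Set.uIoc_of_le (by linarith)] at hx
      have hx0 : 0 < x := hT.trans hx.1
      rw [norm_mul, Real.norm_eq_abs, Real.norm_eq_abs, abs_of_nonneg (Real.rpow_nonneg hx0.le _)]
      calc _ ≤ x ^ α * 1 := by
            gcongr
            exact Real.abs_cos_le_one _
        _ ≤ (2 * T) ^ α := by
            rw [mul_one]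
            exact Real.rpow_le_rpow hx0.le hx.2 hα)
  rw [Real.norm_eq_abs] at h
  refine h.trans_eq ?_
  rw [Real.mul_rpow (by norm_num) hT.le, Real.rpow_add hT, Real.rpow_one,
    show 2 * T - T = T by ring, abs_of_pos hT]
  ring

theorem abs_integral_rpow_mul_cos_le {T α : ℝ} (hT : 0 < T) (hα : 1 ≤ α) {l : ℝ} (hl : l ≠ 0)
    (φ : ℝ) :
    |∫ x in T..(2 * T), x ^ α * Real.cos (l * x ^ (1 / 4 : ℝ) + φ)| ≤
      4 * (α + 3) * 2 ^ (α + 3 / 4) * T ^ (α + 3 / 4) * |l|⁻¹ := by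
  have hderiv : ∀ x ∈ Set.uIcc T (2 * T), HasDerivAt
      (fun x : ℝ => 4 / l * (x ^ (α + 3 / 4) * Real.sin (l * x ^ (1 / 4 : ℝ) + φ)))
      (x ^ α * Real.cos (l * x ^ (1 / 4 : ℝ) + φ) + 4 / l * (α + 3 / 4) *
        (x ^ (α - 1 / 4) * Real.cos (l * x ^ (1 / 4 : ℝ) + (φ - π / 2)))) x := by
    intro x hx
    rw [Set.uIcc_of_le (by linarith)] at hx
    have hx0 : 0 < x := hT.trans_le hx.1
    have h1 : HasDerivAt (fun x : ℝ => x ^ (α + 3 / 4)) ((α + 3 / 4) * x ^ (α - 1 / 4)) x := by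
      have := Real.hasDerivAt_rpow_const (x := x) (p := α + 3 / 4) (Or.inl hx0.ne')
      rwa [show α + 3 / 4 - 1 = α - 1 / 4 by ring] at this
    have h2 : HasDerivAt (fun x : ℝ => l * x ^ (1 / 4 : ℝ) + φ)
        (l * (1 / 4 * x ^ (-(3 / 4) : ℝ))) x := by
      have := Real.hasDerivAt_rpow_const (x := x) (p := 1 / 4) (Or.inl hx0.ne')
      rw [show (1 / 4 - 1 : ℝ) = -(3 / 4) by norm_num] at this
      exact (this.const_mul l).add_const φ
    refine ((h1.mul h2.sin).const_mul (4 / l)).congr_deriv ?_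
    rw [← add_sub_assoc, Real.cos_sub_pi_div_two]
    have h3 : x ^ (α + 3 / 4) * x ^ (-(3 / 4) : ℝ) = x ^ α := by
      rw [← Real.rpow_add hx0]
      congr 1
      ring
    rw [← h3]
    field_simp
    ring
  have hint1 := intervalIntegrable_rpow_mul_cos hT α l φ
  have hint2 := intervalIntegrable_rpow_mul_cos hT (α - 1 / 4) l (φ - π / 2)
  have hmain := intervalIntegral.integral_eq_sub_of_hasDerivAt hderiv
    (hint1.add (hint2.const_mul _))
  rw [intervalIntegral.integral_add hint1 (hint2.const_mul _),
    intervalIntegral.integral_const_mul] at hmain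
  have htriv := abs_integral_rpow_mul_cos_le_trivial hT (by linarith : 0 ≤ α - 1 / 4) l (φ - π / 2)
  set I := ∫ x in T..(2 * T), x ^ α * Real.cos (l * x ^ (1 / 4 : ℝ) + φ)
  set J := ∫ x in T..(2 * T), x ^ (α - 1 / 4) * Real.cos (l * x ^ (1 / 4 : ℝ) + (φ - π / 2))
  set V := 2 ^ (α + 3 / 4) * T ^ (α + 3 / 4) with hV
  have hV0 : 0 ≤ V := by positivity
  have hJ : |J| ≤ V := by
    refine htriv.trans ?_
    rw [hV, show α - 1 / 4 + 1 = α + 3 / 4 by ring]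
    gcongr
    · norm_num
    · linarith
  have hV2 : (2 * T) ^ (α + 3 / 4) = V := Real.mul_rpow (by norm_num) hT.le
  have hV1 : T ^ (α + 3 / 4) ≤ V := by
    rw [← hV2]
    exact Real.rpow_le_rpow hT.le (by linarith) (by linarith)
  have hsin (x z : ℝ) (hx : 0 ≤ x) (hz : x ≤ V) : |x * Real.sin z| ≤ V := by
    rw [abs_mul, abs_of_nonneg hx]
    calc x * |Real.sin z| ≤ x * 1 := by
          gcongr
          exact Real.abs_sin_le_one z
      _ ≤ V := by rwa [mul_one]
  have hI : I = 4 / l * ((2 * T) ^ (α + 3 / 4) * Real.sin (l * (2 * T) ^ (1 / 4 : ℝ) + φ) -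
      T ^ (α + 3 / 4) * Real.sin (l * T ^ (1 / 4 : ℝ) + φ) - (α + 3 / 4) * J) := by
    linear_combination hmain
  rw [hI, abs_mul, abs_div, abs_of_pos (by norm_num : (0 : ℝ) < 4)]
  have h1 := hsin _ (l * (2 * T) ^ (1 / 4 : ℝ) + φ) (by positivity) hV2.le
  have h2 := hsin _ (l * T ^ (1 / 4 : ℝ) + φ) (by positivity) hV1
  have h3 : |(α + 3 / 4) * J| ≤ (α + 3 / 4) * V := by
    rw [abs_mul, abs_of_nonneg (by linarith : 0 ≤ α + 3 / 4)]
    gcongr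
  calc 4 / |l| * _ ≤ 4 / |l| * (V + V + (α + 3 / 4) * V) := by
        gcongr
        refine (abs_sub _ _).trans (add_le_add ((abs_sub _ _).trans (add_le_add h1 h2)) h3)
    _ ≤ 4 / |l| * ((α + 3) * V) := by
        gcongr
        nlinarith
    _ = _ := by
        rw [hV]
        ring

theorem abs_integral_rpow_mul_cos_le_ite {T α : ℝ} (hT : 0 < T) (hα : 1 ≤ α) (δ φ : ℝ) :
    |∫ x in T..(2 * T), x ^ α * Real.cos (8 * π * δ * x ^ (1 / 4 : ℝ) + φ)| ≤
      4 * (α + 3) * 2 ^ (α + 3 / 4) *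
        ((if δ = 0 then T ^ (α + 1) else 0) + T ^ (α + 3 / 4) * |δ|⁻¹) := by
  split_ifs with h
  · refine (abs_integral_rpow_mul_cos_le_trivial hT (by linarith) _ _).trans ?_
    rw [h, abs_zero, inv_zero, mul_zero, add_zero]
    gcongr
    calc (2 : ℝ) ^ α ≤ 1 * 2 ^ (α + 3 / 4) := by
          rw [one_mul]
          gcongr
          · norm_num
          · linarith
      _ ≤ _ := by
          gcongr
          linarith
  · refine (abs_integral_rpow_mul_cos_le hT hα (by positivity) φ).trans ?_
    rw [zero_add, ← mul_assoc]
    refine mul_le_mul_of_nonneg_left (inv_anti₀ (abs_pos.2 h) ?_) (by positivity)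
    rw [abs_mul, abs_of_pos (by positivity : 0 < 8 * π)]
    refine le_mul_of_one_le_left (abs_nonneg _) ?_
    linarith [Real.pi_gt_three]

/-- Product-to-sum formula. -/
theorem prod_cos_mul_cos {ι : Type*} [Fintype ι] [DecidableEq ι] (θ : ι → ℝ) (θ' : ℝ) :
    (∏ i, Real.cos (θ i)) * Real.cos θ' = ∑ s ∈ Fintype.piFinset fun _ : ι => ({1, -1} : Finset ℤ),
      (2 ^ Fintype.card ι)⁻¹ * Real.cos (θ' + ∑ i, (s i : ℝ) * θ i) := by
  have hcos (i) : ((Real.cos (θ i) : ℝ) : ℂ) =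
      ∑ e ∈ ({1, -1} : Finset ℤ), 2⁻¹ * Complex.exp (((e : ℝ) * θ i : ℝ) * Complex.I) := by
    rw [Finset.sum_pair (by norm_num), Complex.ofReal_cos, Complex.cos]
    push_cast
    ring_nf
  have h : ((∏ i, Real.cos (θ i) : ℝ) : ℂ) * Complex.exp (θ' * Complex.I) =
      ∑ s ∈ Fintype.piFinset fun _ : ι => ({1, -1} : Finset ℤ), (((2 ^ Fintype.card ι)⁻¹ : ℝ) : ℂ) *
        Complex.exp ((θ' + ∑ i, (s i : ℝ) * θ i : ℝ) * Complex.I) := by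
    rw [Complex.ofReal_prod, Finset.prod_congr rfl fun i _ => hcos i, Finset.prod_univ_sum,
      Finset.sum_mul]
    refine Finset.sum_congr rfl fun s _ => ?_
    rw [Finset.prod_mul_distrib, Finset.prod_const, Finset.card_univ, ← Complex.exp_sum, mul_assoc,
      ← Complex.exp_add, ← Finset.sum_mul, ← add_mul]
    push_cast
    rw [inv_pow, add_comm]
  have hre := congrArg Complex.re h
  rw [Complex.re_sum, Complex.re_ofReal_mul, Complex.exp_ofReal_mul_I_re] at hre
  rw [hre]
  refine Finset.sum_congr rfl fun s _ => ?_
  rw [Complex.re_ofReal_mul, Complex.exp_ofReal_mul_I_re]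

theorem abs_integral_pow_mul_le {r : ℕ} (hr : 2 ≤ r) {α : ℝ} (hα : 1 ≤ α) :
    ∃ C : ℝ, 0 < C ∧ ∀ (A T y : ℝ) (N : ℕ) (a : ℕ → ℝ), 0 ≤ A → 0 < T → 1 ≤ y → ⌊y⌋₊ ≤ N →
      (∀ n, 1 ≤ n → n ≤ N → |a n| ≤ A * (n : ℝ) ^ (-(7 / 8) : ℝ)) →
      |∫ x in T..(2 * T), x ^ α *
        ((∑ n ∈ Finset.Icc 1 ⌊y⌋₊, a n * Real.cos (8 * π * ((n : ℝ) * x) ^ (1 / 4 : ℝ) - π / 4)) ^ r *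
          ∑ n ∈ Finset.Ioc ⌊y⌋₊ N,
            a n * Real.cos (8 * π * ((n : ℝ) * x) ^ (1 / 4 : ℝ) - π / 4))| ≤
      C * A ^ (r + 1) * (T ^ (α + 1) * (y ^ (-(5 / 4) : ℝ) * (y ^ (1 / 8 : ℝ)) ^ (r - 2)) +
        T ^ (α + 3 / 4) * ((y ^ (1 / 8 : ℝ)) ^ r *
          (y ^ (-(7 / 8) : ℝ) * (y ^ (1 / 4 : ℝ)) ^ (4 ^ r - 1)))) := by
  have hD (s : Fin r → ℤ) := fun hs => diagonal_sum_le (s := s) hs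
  have hO (s : Fin r → ℤ) := fun hs => offdiagonal_sum_le (ι := Fin r) (by simpa using hr) (s := s) hs
  choose! CD hCD0 hCD using hD
  choose! CO hCO0 hCO using hO
  simp only [Fintype.card_fin] at hCD hCO
  set S := Fintype.piFinset fun _ : Fin r => ({1, -1} : Finset ℤ) with hS
  have hSs (s) (hs : s ∈ S) (i : Fin r) : |s i| ≤ 1 := by
    have := Fintype.mem_piFinset.1 hs i
    rw [Finset.mem_insert, Finset.mem_singleton] at this
    rcases this with h | h <;> rw [h] <;> norm_num
  set B := 4 * (α + 3) * (2 : ℝ) ^ (α + 3 / 4) with hB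
  have hB0 : 0 ≤ B := by positivity
  have hCs0 : 0 ≤ ∑ s ∈ S, (CD s + CO s) :=
    Finset.sum_nonneg fun s hs => (add_pos (hCD0 s (hSs s hs)) (hCO0 s (hSs s hs))).le
  refine ⟨B * ∑ s ∈ S, (CD s + CO s) + 1, by positivity, ?_⟩
  intro A T y N a hA hT hy hyN ha
  have hy0 : 0 < y := by linarith
  set P := Fintype.piFinset fun _ : Fin r => Finset.Icc 1 ⌊y⌋₊ with hP
  set M := Finset.Ioc ⌊y⌋₊ N with hM
  let δ (n : Fin r → ℕ) (m : ℕ) (s : Fin r → ℤ) : ℝ :=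
    (m : ℝ) ^ (1 / 4 : ℝ) + ∑ i, (s i : ℝ) * (n i : ℝ) ^ (1 / 4 : ℝ)
  let φ (s : Fin r → ℤ) : ℝ := -(π / 4) + ∑ i, (s i : ℝ) * (-(π / 4))
  let κ (n : Fin r → ℕ) (m : ℕ) : ℝ := (∏ i, a (n i)) * a m * (2 ^ r)⁻¹
  let w : ℕ → ℝ := fun x => (x : ℝ) ^ (-(7 / 8) : ℝ)
  set X := T ^ (α + 1) with hX
  set Y := T ^ (α + 3 / 4) with hY
  have hX0 : 0 ≤ X := by positivity
  have hY0 : 0 ≤ Y := by positivity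
  have hexpand : ∀ x ∈ Set.uIcc T (2 * T), x ^ α *
      ((∑ n ∈ Finset.Icc 1 ⌊y⌋₊, a n * Real.cos (8 * π * ((n : ℝ) * x) ^ (1 / 4 : ℝ) - π / 4)) ^ r *
        ∑ n ∈ M, a n * Real.cos (8 * π * ((n : ℝ) * x) ^ (1 / 4 : ℝ) - π / 4)) =
      ∑ s ∈ S, ∑ n ∈ P, ∑ m ∈ M, κ n m *
        (x ^ α * Real.cos (8 * π * δ n m s * x ^ (1 / 4 : ℝ) + φ s)) := by
    intro x hx
    rw [Set.uIcc_of_le (by linarith)] at hx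
    have hx0 : 0 ≤ x := hT.le.trans hx.1
    have hpow := Finset.prod_univ_sum (ι := Fin r) (fun _ => Finset.Icc 1 ⌊y⌋₊)
      (fun _ (n : ℕ) => a n * Real.cos (8 * π * ((n : ℝ) * x) ^ (1 / 4 : ℝ) - π / 4))
    rw [Finset.prod_const, Finset.card_univ, Fintype.card_fin] at hpow
    rw [hpow, Finset.sum_mul_sum, Finset.mul_sum, Finset.sum_comm]
    refine Finset.sum_congr rfl fun n _ => ?_
    rw [Finset.mul_sum, Finset.sum_comm]
    refine Finset.sum_congr rfl fun m _ => ?_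
    rw [Finset.prod_mul_distrib, mul_mul_mul_comm, prod_cos_mul_cos, Fintype.card_fin,
      Finset.mul_sum, Finset.mul_sum]
    refine Finset.sum_congr rfl fun s _ => ?_
    have harg : 8 * π * ((m : ℝ) * x) ^ (1 / 4 : ℝ) - π / 4 +
        ∑ i, (s i : ℝ) * (8 * π * ((n i : ℝ) * x) ^ (1 / 4 : ℝ) - π / 4) =
        8 * π * δ n m s * x ^ (1 / 4 : ℝ) + φ s := by
      simp only [δ, φ, Real.mul_rpow (Nat.cast_nonneg _) hx0, mul_add, add_mul, Finset.mul_sum,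
        Finset.sum_mul]
      rw [sub_eq_add_neg, add_add_add_comm, ← Finset.sum_add_distrib]
      congr 1
      · congr 1
        ring
      · refine Finset.sum_congr rfl fun i _ => ?_
        ring
    rw [harg]
    ring
  have hκ (n) (hn : n ∈ P) (m) (hm : m ∈ M) : |κ n m| ≤ A ^ (r + 1) * ((∏ i, w (n i)) * w m) := by
    have hmM := Finset.mem_Ioc.1 hm
    have h1 : |∏ i, a (n i)| ≤ ∏ i, (A * w (n i)) := by
      rw [Finset.abs_prod]
      refine Finset.prod_le_prod (fun i _ => abs_nonneg _) fun i _ => ?_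
      have := Finset.mem_Icc.1 (Fintype.mem_piFinset.1 hn i)
      exact ha _ this.1 (this.2.trans hyN)
    have h2 : |a m| ≤ A * w m := ha m (by omega) hmM.2
    have h3 : |((2 : ℝ) ^ r)⁻¹| ≤ 1 := by
      rw [abs_of_pos (by positivity)]
      exact inv_le_one_of_one_le₀ (one_le_pow₀ (by norm_num))
    have h4 : 0 ≤ ∏ i, (A * w (n i)) :=
      Finset.prod_nonneg fun i _ => mul_nonneg hA (by positivity)
    calc |κ n m| = |∏ i, a (n i)| * |a m| * |((2 : ℝ) ^ r)⁻¹| := by rw [abs_mul, abs_mul]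
      _ ≤ (∏ i, (A * w (n i))) * (A * w m) * 1 := by gcongr
      _ = _ := by
        rw [Finset.prod_mul_distrib, Finset.prod_const, Finset.card_univ, Fintype.card_fin]
        ring
  set U := y ^ (-(5 / 4) : ℝ) * (y ^ (1 / 8 : ℝ)) ^ (r - 2) with hU
  set V := (y ^ (1 / 8 : ℝ)) ^ r * (y ^ (-(7 / 8) : ℝ) * (y ^ (1 / 4 : ℝ)) ^ (4 ^ r - 1)) with hV
  have hU0 : 0 ≤ U := by positivity
  have hV0 : 0 ≤ V := by positivity
  have hint (s n m) : IntervalIntegrable (fun x : ℝ => κ n m *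
      (x ^ α * Real.cos (8 * π * δ n m s * x ^ (1 / 4 : ℝ) + φ s))) MeasureTheory.volume T (2 * T) :=
    (intervalIntegrable_rpow_mul_cos hT _ _ _).const_mul _
  have hintM (s n) : IntervalIntegrable (fun x : ℝ => ∑ m ∈ M, κ n m *
      (x ^ α * Real.cos (8 * π * δ n m s * x ^ (1 / 4 : ℝ) + φ s)))
      MeasureTheory.volume T (2 * T) := by
    have h := IntervalIntegrable.sum M fun m _ => hint s n m
    rwa [Finset.sum_fn] at h
  have hintP (s) : IntervalIntegrable (fun x : ℝ => ∑ n ∈ P, ∑ m ∈ M, κ n m *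
      (x ^ α * Real.cos (8 * π * δ n m s * x ^ (1 / 4 : ℝ) + φ s)))
      MeasureTheory.volume T (2 * T) := by
    have h := IntervalIntegrable.sum P fun n _ => hintM s n
    rwa [Finset.sum_fn] at h
  rw [intervalIntegral.integral_congr hexpand,
    intervalIntegral.integral_finsetSum fun s _ => hintP s]
  have hs_bound (s) (hs : s ∈ S) : |∫ x in T..(2 * T), ∑ n ∈ P, ∑ m ∈ M, κ n m *
        (x ^ α * Real.cos (8 * π * δ n m s * x ^ (1 / 4 : ℝ) + φ s))| ≤
      B * A ^ (r + 1) * ((CD s + CO s) * (X * U + Y * V)) := by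
    rw [intervalIntegral.integral_finsetSum fun n _ => hintM s n]
    have hterm (n) (hn : n ∈ P) (m) (hm : m ∈ M) :
        |∫ x in T..(2 * T), κ n m *
          (x ^ α * Real.cos (8 * π * δ n m s * x ^ (1 / 4 : ℝ) + φ s))| ≤
        B * A ^ (r + 1) * (X * (if δ n m s = 0 then (∏ i, w (n i)) * w m else 0) +
          Y * ((∏ i, w (n i)) * w m * |δ n m s|⁻¹)) := by
      rw [intervalIntegral.integral_const_mul, abs_mul]
      have h1 := abs_integral_rpow_mul_cos_le_ite hT hα (δ n m s) (φ s)
      have h2 := hκ n hn m hm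
      calc _ ≤ (A ^ (r + 1) * ((∏ i, w (n i)) * w m)) *
            (B * ((if δ n m s = 0 then X else 0) + Y * |δ n m s|⁻¹)) :=
            mul_le_mul h2 h1 (abs_nonneg _) ((abs_nonneg _).trans h2)
        _ = _ := by
            split_ifs <;> ring
    have h1 : |∑ n ∈ P, ∫ x in T..(2 * T), ∑ m ∈ M, κ n m *
          (x ^ α * Real.cos (8 * π * δ n m s * x ^ (1 / 4 : ℝ) + φ s))| ≤
        ∑ n ∈ P, ∑ m ∈ M, B * A ^ (r + 1) *
          (X * (if δ n m s = 0 then (∏ i, w (n i)) * w m else 0) +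
          Y * ((∏ i, w (n i)) * w m * |δ n m s|⁻¹)) := by
      refine (Finset.abs_sum_le_sum_abs _ _).trans (Finset.sum_le_sum fun n hn => ?_)
      rw [intervalIntegral.integral_finsetSum (fun m _ => hint s n m)]
      exact (Finset.abs_sum_le_sum_abs _ _).trans (Finset.sum_le_sum fun m hm => hterm n hn m hm)
    refine h1.trans ?_
    simp only [← Finset.mul_sum, Finset.sum_add_distrib]
    have h2 := hCD s (hSs s hs) y N hy
    have h3 := hCO s (hSs s hs) y N hy
    have h4 := hCD0 s (hSs s hs)
    have h5 := hCO0 s (hSs s hs)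
    refine mul_le_mul_of_nonneg_left ?_ (by positivity)
    calc _ ≤ X * (CD s * U) + Y * (CO s * V) :=
          add_le_add (mul_le_mul_of_nonneg_left h2 hX0) (mul_le_mul_of_nonneg_left h3 hY0)
      _ ≤ X * (CD s * U) + Y * (CO s * V) + (X * (CO s * U) + Y * (CD s * V)) :=
          le_add_of_nonneg_right (by positivity)
      _ = _ := by ring
  calc _ ≤ ∑ s ∈ S, B * A ^ (r + 1) * ((CD s + CO s) * (X * U + Y * V)) :=
        (Finset.abs_sum_le_sum_abs _ _).trans (Finset.sum_le_sum hs_bound)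
    _ = (B * ∑ s ∈ S, (CD s + CO s)) * A ^ (r + 1) * (X * U + Y * V) := by
        rw [← Finset.mul_sum, ← Finset.sum_mul]
        ring
    _ ≤ _ := by
        gcongr
        linarith

theorem stmt_16 (c : ℕ → ℝ) (hc0 : ∀ n, 0 ≤ c n)
    (hc : ∀ ε : ℝ, 0 < ε → ∃ K : ℝ, 0 < K ∧ ∀ n : ℕ, 1 ≤ n → c n ≤ K * (n : ℝ) ^ ε)
    (k : ℕ) (hk : k = 3 ∨ k = 4 ∨ k = 5) (ε : ℝ) (hε : 0 < ε) :
    ∃ C : ℝ, 0 < C ∧ ∀ T y : ℝ, 10 ≤ T → 2 ≤ y → y ≤ T / (2 * (k : ℝ)) →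
      |∫ x in T..(2 * T),
          (R1 c x y) ^ (k - 1) *
            (((2 * π) ^ 2)⁻¹ * x ^ ((9 : ℝ) / 8) *
              ∑ n ∈ Finset.Ioc ⌊y⌋₊ ⌊T⌋₊,
                c n / (n : ℝ) ^ ((7 : ℝ) / 8) *
                  Real.cos (8 * π * ((n : ℝ) * x) ^ ((1 : ℝ) / 4) - π / 4))| ≤
        C * (T ^ (1 + 9 * (k : ℝ) / 8 + ε) * y ^ (-(3 : ℝ) / 4) +
          T ^ (3 / 4 + 9 * (k : ℝ) / 8 + ε) * y ^ ((4 : ℝ) ^ (k - 2) - 5 / 4 + (k : ℝ) / 8)) := by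
  have hk3 : 3 ≤ k := by omega
  have hk0 : (0 : ℝ) < k := by positivity
  have hkr : (3 : ℝ) ≤ k := by exact_mod_cast hk3
  obtain ⟨K, hK, hcK⟩ := hc (ε / k) (by positivity)
  obtain ⟨C, hC, h⟩ := abs_integral_pow_mul_le (r := k - 1) (by omega) (α := 9 * (k : ℝ) / 8)
    (by linarith)
  have hk1 : k - 1 + 1 = k := by omega
  rw [hk1] at h
  refine ⟨((4 * π ^ 2)⁻¹) ^ k * (C * K ^ k), by positivity, fun T y hT hy hyT => ?_⟩
  have hT0 : 0 < T := by linarith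
  have hy0 : 0 < y := by linarith
  have hyT' : y ≤ T := hyT.trans (div_le_self hT0.le (by linarith))
  have hcongr : ∀ x ∈ Set.uIcc T (2 * T), (R1 c x y) ^ (k - 1) *
      (((2 * π) ^ 2)⁻¹ * x ^ ((9 : ℝ) / 8) * ∑ n ∈ Finset.Ioc ⌊y⌋₊ ⌊T⌋₊,
        c n / (n : ℝ) ^ ((7 : ℝ) / 8) * Real.cos (8 * π * ((n : ℝ) * x) ^ ((1 : ℝ) / 4) - π / 4)) =
      ((4 * π ^ 2)⁻¹) ^ k * (x ^ (9 * (k : ℝ) / 8) * ((∑ n ∈ Finset.Icc 1 ⌊y⌋₊,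
        c n / (n : ℝ) ^ ((7 : ℝ) / 8) *
          Real.cos (8 * π * ((n : ℝ) * x) ^ ((1 : ℝ) / 4) - π / 4)) ^ (k - 1) *
        ∑ n ∈ Finset.Ioc ⌊y⌋₊ ⌊T⌋₊, c n / (n : ℝ) ^ ((7 : ℝ) / 8) *
          Real.cos (8 * π * ((n : ℝ) * x) ^ ((1 : ℝ) / 4) - π / 4))) := by
    intro x hx
    rw [Set.uIcc_of_le (by linarith)] at hx
    have hx0 : 0 < x := hT0.trans_le hx.1
    have h1 : x ^ (9 * (k : ℝ) / 8) = (x ^ ((9 : ℝ) / 8)) ^ (k - 1) * x ^ ((9 : ℝ) / 8) := by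
      rw [← pow_succ, hk1, ← Real.rpow_natCast, ← Real.rpow_mul hx0.le]
      congr 1
      ring
    have h2 : ((4 * π ^ 2)⁻¹) ^ k = ((4 * π ^ 2)⁻¹) ^ (k - 1) * ((2 * π) ^ 2)⁻¹ := by
      rw [show (2 * π) ^ 2 = 4 * π ^ 2 by ring, ← pow_succ, hk1]
    rw [R1, mul_pow, div_eq_mul_inv, mul_pow, h1, h2]
    ring
  rw [intervalIntegral.integral_congr hcongr, intervalIntegral.integral_const_mul, abs_mul,
    abs_of_pos (by positivity : 0 < ((4 * π ^ 2)⁻¹) ^ k), mul_assoc]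
  refine mul_le_mul_of_nonneg_left ?_ (by positivity)
  refine (h (K * T ^ (ε / k)) T y ⌊T⌋₊ (fun n => c n / (n : ℝ) ^ ((7 : ℝ) / 8)) (by positivity) hT0
    (by linarith) (Nat.floor_le_floor hyT') fun n hn1 hnT => ?_).trans ?_
  · have hn0 : (0 : ℝ) < n := by exact_mod_cast hn1
    have hnT' : (n : ℝ) ≤ T := (Nat.le_floor_iff hT0.le).1 hnT
    rw [abs_of_nonneg (div_nonneg (hc0 n) (by positivity)), Real.rpow_neg hn0.le, div_eq_mul_inv]
    gcongr
    exact (hcK n hn1).trans (by gcongr)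
  · have hA : (K * T ^ (ε / k)) ^ k = K ^ k * T ^ ε := by
      rw [mul_pow, ← Real.rpow_natCast, ← Real.rpow_natCast, ← Real.rpow_mul hT0.le,
        div_mul_cancel₀ _ hk0.ne']
    have hX : T ^ ε * T ^ (9 * (k : ℝ) / 8 + 1) = T ^ (1 + 9 * (k : ℝ) / 8 + ε) := by
      rw [← Real.rpow_add hT0]
      congr 1
      ring
    have hY : T ^ ε * T ^ (9 * (k : ℝ) / 8 + 3 / 4) = T ^ (3 / 4 + 9 * (k : ℝ) / 8 + ε) := by
      rw [← Real.rpow_add hT0]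
      congr 1
      ring
    have hU : y ^ (-(5 / 4) : ℝ) * (y ^ (1 / 8 : ℝ)) ^ (k - 1 - 2) ≤ y ^ (-(3 : ℝ) / 4) := by
      rw [← Real.rpow_natCast, ← Real.rpow_mul hy0.le, ← Real.rpow_add hy0]
      refine Real.rpow_le_rpow_of_exponent_le (by linarith) ?_
      rcases hk with rfl | rfl | rfl <;> norm_num
    have hV : (y ^ (1 / 8 : ℝ)) ^ (k - 1) * (y ^ (-(7 / 8) : ℝ) *
        (y ^ (1 / 4 : ℝ)) ^ (4 ^ (k - 1) - 1)) = y ^ ((4 : ℝ) ^ (k - 2) - 5 / 4 + (k : ℝ) / 8) := by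
      rw [← Real.rpow_natCast, ← Real.rpow_natCast, ← Real.rpow_mul hy0.le, ← Real.rpow_mul hy0.le,
        ← Real.rpow_add hy0, ← Real.rpow_add hy0]
      congr 1
      rcases hk with rfl | rfl | rfl <;> norm_num
    rw [hA, hV, ← hX, ← hY]
    calc _ ≤ C * (K ^ k * T ^ ε) * (T ^ (9 * (k : ℝ) / 8 + 1) * y ^ (-(3 : ℝ) / 4) +
          T ^ (9 * (k : ℝ) / 8 + 3 / 4) * y ^ ((4 : ℝ) ^ (k - 2) - 5 / 4 + (k : ℝ) / 8)) := by
          gcongr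
      _ = _ := by ring
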